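/- Let n ≥ 5. For every Λ > 0 there exists α₀ > 0 such that for every α ≥ α₀ there is no positive ℤⁿ-periodic C⁴ function u : ℝⁿ → ℝ satisfying (Δ + α/2)²u = u^{(n+4)/(n−4)} on ℝⁿ and ∫_{[0,1]ⁿ} u^{2n/(n−4)} dx ≤ Λ. Equivalently, on the flat torus the minimal energy E_m(α) of positive solutions of (Δ + α/2)²u = u^{2♯−1} tends to +∞ as α → +∞. -/

import Mathlib

open MeasureTheory Real Filter

noncomputable section

/-- `ℝⁿ` as Euclidean space. -/
abbrev En (n : ℕ) := EuclideanSpace ℝ (Fin n)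

/-- Partial derivative in the `i`-th coordinate direction. -/
def pderiv' {n : ℕ} (i : Fin n) (u : En n → ℝ) : En n → ℝ :=
  fun x => fderiv ℝ u x (EuclideanSpace.single i 1)

/-- The geometers' Laplacian `Δu = -∑ ∂²u/∂xᵢ²`. -/
def lap {n : ℕ} (u : En n → ℝ) : En n → ℝ :=
  fun x => -∑ i, pderiv' i (pderiv' i u) x

/-- The unit cube `[0,1]ⁿ`. -/
def unitCube (n : ℕ) : Set (En n) := {x | ∀ i, x i ∈ Set.Icc (0 : ℝ) 1}

/-- ℤⁿ-periodicity. -/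
def ZPeriodic {n : ℕ} (u : En n → ℝ) : Prop :=
  ∀ (x : En n) (k : Fin n → ℤ),
    u (x + (WithLp.equiv 2 (Fin n → ℝ)).symm (fun i => (k i : ℝ))) = u x


/-! ### Basic calculus of partial derivatives -/

theorem pd_contDiff {n : ℕ} {m : ℕ} (i : Fin n) {f : En n → ℝ}
    (hf : ContDiff ℝ ((m + 1 : ℕ) : WithTop ℕ∞) f) :
    ContDiff ℝ (m : WithTop ℕ∞) (pderiv' i f) := by
  unfold pderiv'
  have h : ContDiff ℝ (m : WithTop ℕ∞) (fderiv ℝ f) :=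
    hf.fderiv_right (by push_cast; exact le_rfl)
  exact h.clm_apply contDiff_const

theorem pd_add {n : ℕ} (i : Fin n) {f g : En n → ℝ}
    (hf : Differentiable ℝ f) (hg : Differentiable ℝ g) (x : En n) :
    pderiv' i (fun y => f y + g y) x = pderiv' i f x + pderiv' i g x := by
  unfold pderiv'
  rw [fderiv_fun_add (hf x) (hg x)]; rfl

theorem pd_sub {n : ℕ} (i : Fin n) {f g : En n → ℝ}
    (hf : Differentiable ℝ f) (hg : Differentiable ℝ g) (x : En n) :
    pderiv' i (fun y => f y - g y) x = pderiv' i f x - pderiv' i g x := by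
  unfold pderiv'
  rw [fderiv_fun_sub (hf x) (hg x)]; rfl

theorem pd_mul {n : ℕ} (i : Fin n) {f g : En n → ℝ}
    (hf : Differentiable ℝ f) (hg : Differentiable ℝ g) (x : En n) :
    pderiv' i (fun y => f y * g y) x = pderiv' i f x * g x + f x * pderiv' i g x := by
  unfold pderiv'
  rw [fderiv_fun_mul (hf x) (hg x)]
  simp; ring

theorem pd_const_mul {n : ℕ} (i : Fin n) (c : ℝ) {f : En n → ℝ}
    (hf : Differentiable ℝ f) (x : En n) :
    pderiv' i (fun y => c * f y) x = c * pderiv' i f x := by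
  unfold pderiv'
  rw [fderiv_const_mul (hf x)]
  simp

theorem pd_neg {n : ℕ} (i : Fin n) {f : En n → ℝ} (x : En n) :
    pderiv' i (fun y => - f y) x = - pderiv' i f x := by
  unfold pderiv'
  rw [fderiv_fun_neg]
  simp

theorem pd_sum {n : ℕ} {ι : Type*} (s : Finset ι) (i : Fin n) {f : ι → En n → ℝ}
    (hf : ∀ j, Differentiable ℝ (f j)) (x : En n) :
    pderiv' i (fun y => ∑ j ∈ s, f j y) x = ∑ j ∈ s, pderiv' i (f j) x := by
  unfold pderiv'
  rw [fderiv_fun_sum (fun j _ => hf j x)]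
  simp

theorem pd_coord {n : ℕ} (i j : Fin n) {φ : ℝ → ℝ}
    (hφ : Differentiable ℝ φ) (x : En n) :
    pderiv' j (fun y => φ (y i)) x = if j = i then deriv φ (x i) else 0 := by
  unfold pderiv'
  have h1 : HasFDerivAt (fun y : En n => y i) (EuclideanSpace.proj i : En n →L[ℝ] ℝ) x :=
    (EuclideanSpace.proj i : En n →L[ℝ] ℝ).hasFDerivAt
  have h2 := (hφ (x i)).hasDerivAt.comp_hasFDerivAt x h1
  have h3 : fderiv ℝ (fun y : En n => φ (y i)) x = _ := h2.fderiv
  rw [h3]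
  by_cases h : j = i
  · subst h; simp
  · have h' : ¬ (i = j) := fun e => h e.symm
    simp [h, h']

theorem pd_rpow {n : ℕ} (i : Fin n) {f : En n → ℝ} (p : ℝ)
    (hf : Differentiable ℝ f) (hpos : ∀ x, 0 < f x) (x : En n) :
    pderiv' i (fun y => f y ^ p) x = p * f x ^ (p - 1) * pderiv' i f x := by
  unfold pderiv'
  have h := (hf x).hasFDerivAt.rpow_const (p := p) (Or.inl (hpos x).ne')
  rw [h.fderiv]; simp

theorem pd_comm {n : ℕ} (i j : Fin n) {f : En n → ℝ} (hf : ContDiff ℝ 2 f) (x : En n) :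
    pderiv' i (pderiv' j f) x = pderiv' j (pderiv' i f) x := by
  have hd : Differentiable ℝ (fderiv ℝ f) :=
    (hf.fderiv_right (m := 1) (by norm_num)).differentiable (by norm_num)
  have key : ∀ v w : En n, fderiv ℝ (fun y => fderiv ℝ f y v) x w
      = fderiv ℝ (fderiv ℝ f) x w v := by
    intro v w
    have := ((hd x).hasFDerivAt.clm_apply (hasFDerivAt_const v x)).fderiv
    rw [this]; simp
  unfold pderiv'
  rw [key, key]
  have hs : IsSymmSndFDerivAt ℝ f x :=
    hf.contDiffAt.isSymmSndFDerivAt (by simp)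
  exact hs _ _

theorem pd_periodic {n : ℕ} (i : Fin n) {f : En n → ℝ} (hf : ZPeriodic f) :
    ZPeriodic (pderiv' i f) := by
  intro x k
  unfold pderiv'
  have h : (fun y => f (y + (WithLp.equiv 2 (Fin n → ℝ)).symm (fun i => (k i : ℝ)))) = f :=
    funext fun y => hf y k
  rw [← fderiv_comp_add_right, h]

theorem lap_periodic {n : ℕ} {f : En n → ℝ} (hf : ZPeriodic f) : ZPeriodic (lap f) := by
  intro x k
  unfold lap
  congr 1
  exact Finset.sum_congr rfl fun i _ => pd_periodic i (pd_periodic i hf) x k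

theorem lap_contDiff {n : ℕ} {m : ℕ} {f : En n → ℝ}
    (hf : ContDiff ℝ ((m + 2 : ℕ) : WithTop ℕ∞) f) :
    ContDiff ℝ (m : WithTop ℕ∞) (lap f) := by
  unfold lap
  refine (ContDiff.sum fun i _ => ?_).neg
  exact pd_contDiff i (pd_contDiff (m := m + 1) i hf)

/-! ### Integration over the unit cube -/

theorem unitCube_eq_preimage (n : ℕ) :
    unitCube n = (MeasurableEquiv.toLp 2 (Fin n → ℝ)).symm ⁻¹' (Set.Icc 0 1) := by
  ext x
  simp only [unitCube, Set.mem_ofPred_eq, Set.mem_preimage, Set.mem_Icc, Pi.le_def, ← forall_and]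
  rfl

theorem integral_unitCube (n : ℕ) (f : En n → ℝ) :
    ∫ x in unitCube n, f x
      = ∫ y in Set.Icc (0 : Fin n → ℝ) 1, f (WithLp.toLp 2 y) := by
  rw [unitCube_eq_preimage]
  have h := (EuclideanSpace.volume_preserving_symm_measurableEquiv_toLp (Fin n))
  exact h.setIntegral_preimage_emb (MeasurableEquiv.measurableEmbedding _)
    (fun y => f (WithLp.toLp 2 y)) (Set.Icc 0 1)

theorem isCompact_unitCube (n : ℕ) : IsCompact (unitCube n) := by
  rw [unitCube_eq_preimage]
  exact (PiLp.homeomorph 2 (fun _ : Fin n => ℝ)).isCompact_preimage.2 isCompact_Icc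

theorem int_cont {n : ℕ} {f : En n → ℝ} (hf : Continuous f) :
    IntegrableOn f (unitCube n) :=
  hf.continuousOn.integrableOn_compact (isCompact_unitCube n)

theorem integral_pd {n : ℕ} (i : Fin n) {F : En n → ℝ} (hF : ContDiff ℝ 1 F)
    (hp : ZPeriodic F) : ∫ x in unitCube n, pderiv' i F x = 0 := by
  cases n with
  | zero => exact i.elim0
  | succ m =>
  rw [integral_unitCube]
  have hlin : ∀ y : Fin (m+1) → ℝ, HasFDerivAt (fun y : Fin (m+1) → ℝ => (WithLp.toLp 2 y : En (m+1)))
      ((PiLp.continuousLinearEquiv 2 ℝ (fun _ : Fin (m+1) => ℝ)).symm :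
        (Fin (m+1) → ℝ) →L[ℝ] En (m+1)) y := fun y =>
    ((PiLp.continuousLinearEquiv 2 ℝ (fun _ : Fin (m+1) => ℝ)).symm :
        (Fin (m+1) → ℝ) →L[ℝ] En (m+1)).hasFDerivAt
  have hd : Differentiable ℝ F := hF.differentiable (by norm_num)
  have hcont : Continuous (fun y : Fin (m+1) → ℝ => (WithLp.toLp 2 y : En (m+1))) :=
    PiLp.continuous_toLp 2 _
  have h := integral_divergence_of_hasFDerivAt_off_countable' (0 : Fin (m+1) → ℝ) 1 (by simp)
    (fun j y => if j = i then F (WithLp.toLp 2 y) else 0)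
    (fun j y => if j = i then (fderiv ℝ F (WithLp.toLp 2 y)).comp
      ((PiLp.continuousLinearEquiv 2 ℝ (fun _ : Fin (m+1) => ℝ)).symm :
        (Fin (m+1) → ℝ) →L[ℝ] En (m+1)) else 0) ∅ Set.countable_empty
    (by
      intro j
      by_cases hj : j = i
      · simp only [hj, if_true]
        exact (hF.continuous.comp hcont).continuousOn
      · simp only [hj, if_false]; exact continuousOn_const)
    (by
      intro y _ j
      by_cases hj : j = i
      · simp only [hj, if_true]
        exact (hd _).hasFDerivAt.comp y (hlin y)
      · simp only [hj, if_false]; exact hasFDerivAt_const _ _)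
  have hsum : ∀ y : Fin (m+1) → ℝ, (∑ j, (if j = i then (fderiv ℝ F (WithLp.toLp 2 y)).comp
      ((PiLp.continuousLinearEquiv 2 ℝ (fun _ : Fin (m+1) => ℝ)).symm :
        (Fin (m+1) → ℝ) →L[ℝ] En (m+1)) else 0) (Pi.single j 1))
      = pderiv' i F (WithLp.toLp 2 y) := by
    intro y
    rw [Finset.sum_eq_single i]
    · simp [pderiv']
    · intro j _ hj; simp [hj]
    · simp
  simp only [hsum] at h
  rw [h]
  · rw [Finset.sum_eq_single i]
    · simp only [if_true]
      rw [sub_eq_zero]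
      congr 1
      ext y
      have := hp (WithLp.toLp 2 (i.insertNth ((0 : Fin (m+1) → ℝ) i) y)) (Pi.single i 1)
      rw [← this]
      congr 1
      ext j
      refine Fin.succAboveCases i ?_ (fun k => ?_) j
      · simp
      · simp
    · intro j _ hj; simp [hj]
    · simp
  · have : Continuous (fun y : Fin (m+1) → ℝ => pderiv' i F (WithLp.toLp 2 y)) :=
      (pd_contDiff (m := 0) i (by simpa using hF)).continuous.comp hcont
    exact this.continuousOn.integrableOn_compact isCompact_Icc

/-! ### Linearity helpers and integral identities -/

theorem I_add {n : ℕ} {f g : En n → ℝ} (hf : Continuous f) (hg : Continuous g) :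
    ∫ x in unitCube n, (f x + g x) = (∫ x in unitCube n, f x) + ∫ x in unitCube n, g x :=
  integral_add (int_cont hf) (int_cont hg)

theorem I_sub {n : ℕ} {f g : En n → ℝ} (hf : Continuous f) (hg : Continuous g) :
    ∫ x in unitCube n, (f x - g x) = (∫ x in unitCube n, f x) - ∫ x in unitCube n, g x :=
  integral_sub (int_cont hf) (int_cont hg)

theorem I_smul {n : ℕ} (c : ℝ) (f : En n → ℝ) :
    ∫ x in unitCube n, (c * f x) = c * ∫ x in unitCube n, f x :=
  integral_const_mul c f

theorem I_sum {n : ℕ} {ι : Type*} (s : Finset ι) {f : ι → En n → ℝ}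
    (hf : ∀ i, Continuous (f i)) :
    ∫ x in unitCube n, (∑ i ∈ s, f i x) = ∑ i ∈ s, ∫ x in unitCube n, f i x :=
  integral_finsetSum s (fun i _ => int_cont (hf i))

theorem measurableSet_unitCube (n : ℕ) : MeasurableSet (unitCube n) :=
  (isCompact_unitCube n).measurableSet

theorem I_mono {n : ℕ} {f g : En n → ℝ} (hf : Continuous f) (hg : Continuous g)
    (h : ∀ x, f x ≤ g x) :
    ∫ x in unitCube n, f x ≤ ∫ x in unitCube n, g x :=
  setIntegral_mono (int_cont hf) (int_cont hg) h

theorem I_nonneg {n : ℕ} {f : En n → ℝ} (h : ∀ x, 0 ≤ f x) :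
    0 ≤ ∫ x in unitCube n, f x :=
  integral_nonneg h

theorem periodic_mul {n : ℕ} {f g : En n → ℝ} (hf : ZPeriodic f) (hg : ZPeriodic g) :
    ZPeriodic (fun x => f x * g x) := by
  intro x k; simp only [hf x k, hg x k]

theorem periodic_add {n : ℕ} {f g : En n → ℝ} (hf : ZPeriodic f) (hg : ZPeriodic g) :
    ZPeriodic (fun x => f x + g x) := by
  intro x k; simp only [hf x k, hg x k]

theorem periodic_sub {n : ℕ} {f g : En n → ℝ} (hf : ZPeriodic f) (hg : ZPeriodic g) :
    ZPeriodic (fun x => f x - g x) := by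
  intro x k; simp only [hf x k, hg x k]

theorem periodic_comp {n : ℕ} {f : En n → ℝ} (hf : ZPeriodic f) (F : ℝ → ℝ) :
    ZPeriodic (fun x => F (f x)) := by
  intro x k; simp only [hf x k]

theorem periodic_coord {n : ℕ} (i : Fin n) {φ : ℝ → ℝ} (h : Function.Periodic φ 1) :
    ZPeriodic (fun x : En n => φ (x i)) := by
  intro x k
  have := (h.int_mul (k i)) (x i)
  simpa using this

theorem contDiff_coord {n : ℕ} {m : WithTop ℕ∞} (i : Fin n) {φ : ℝ → ℝ} (h : ContDiff ℝ m φ) :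
    ContDiff ℝ m (fun x : En n => φ (x i)) :=
  h.comp (EuclideanSpace.proj i : En n →L[ℝ] ℝ).contDiff

theorem integral_lap_grad {n : ℕ} {f h : En n → ℝ} (hf : ContDiff ℝ 1 f) (hh : ContDiff ℝ 2 h)
    (pf : ZPeriodic f) (ph : ZPeriodic h) :
    ∫ x in unitCube n, f x * lap h x
      = ∑ j, ∫ x in unitCube n, pderiv' j f x * pderiv' j h x := by
  have hD : ∀ j, ContDiff ℝ 1 (pderiv' j h) := fun j => pd_contDiff (m := 1) j hh
  have hDD : ∀ j, Continuous (pderiv' j (pderiv' j h)) := fun j =>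
    (pd_contDiff (m := 0) j (hD j)).continuous
  have hDf : ∀ j, Continuous (pderiv' j f) := fun j => (pd_contDiff (m := 0) j hf).continuous
  have hfc := hf.continuous
  have hDc := fun j => (hD j).continuous
  have key : ∀ j, ∫ x in unitCube n, (f x * pderiv' j (pderiv' j h) x)
      = - ∫ x in unitCube n, pderiv' j f x * pderiv' j h x := by
    intro j
    have h0 := integral_pd j (F := fun x => f x * pderiv' j h x) (hf.mul (hD j))
      (periodic_mul pf (pd_periodic j ph))
    have h1 : ∀ x, pderiv' j (fun x => f x * pderiv' j h x) x
        = pderiv' j f x * pderiv' j h x + f x * pderiv' j (pderiv' j h) x := fun x =>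
      pd_mul j (hf.differentiable (by norm_num)) ((hD j).differentiable (by norm_num)) x
    simp only [h1] at h0
    have e1 := hDf j
    have e2 := hDc j
    have e3 := hDD j
    rw [I_add (by fun_prop) (by fun_prop)] at h0
    linarith
  have : ∀ x, f x * lap h x = - ∑ j, f x * pderiv' j (pderiv' j h) x := by
    intro x; unfold lap; rw [mul_neg, Finset.mul_sum]
  simp only [this]
  rw [integral_neg, I_sum]
  · rw [← Finset.sum_neg_distrib]
    exact Finset.sum_congr rfl fun j _ => by rw [key j]; ring
  · intro j; have e3 := hDD j; fun_prop

theorem integral_lap_symm {n : ℕ} {f h : En n → ℝ} (hf : ContDiff ℝ 2 f) (hh : ContDiff ℝ 2 h)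
    (pf : ZPeriodic f) (ph : ZPeriodic h) :
    ∫ x in unitCube n, f x * lap h x = ∫ x in unitCube n, h x * lap f x := by
  rw [integral_lap_grad (hf.of_le (by norm_num)) hh pf ph,
    integral_lap_grad (hh.of_le (by norm_num)) hf ph pf]
  simp only [mul_comm]

theorem lap_coord_mul {n : ℕ} (i : Fin n) {φ : ℝ → ℝ} (hφ : ContDiff ℝ 2 φ) {f : En n → ℝ}
    (hf : ContDiff ℝ 2 f) (x : En n) :
    lap (fun y => φ (y i) * f y) x
      = φ (x i) * lap f x - 2 * deriv φ (x i) * pderiv' i f x - deriv (deriv φ) (x i) * f x := by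
  have dφ : Differentiable ℝ φ := hφ.differentiable (by norm_num)
  have hφ' : ContDiff ℝ 1 (deriv φ) := by
    have := (contDiff_succ_iff_deriv (n := 1) (f := φ) (𝕜 := ℝ)).1 (by simpa [one_add_one_eq_two] using hφ)
    exact this.2.2
  have dφ' : Differentiable ℝ (deriv φ) := hφ'.differentiable (by norm_num)
  have df : Differentiable ℝ f := hf.differentiable (by norm_num)
  have hD : ∀ j, Differentiable ℝ (pderiv' j f) := fun j =>
    (pd_contDiff (m := 1) j hf).differentiable (by norm_num)
  have dc : Differentiable ℝ (fun y : En n => φ (y i)) :=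
    (contDiff_coord i hφ).differentiable (by norm_num)
  have dc' : Differentiable ℝ (fun y : En n => deriv φ (y i)) :=
    (contDiff_coord i hφ').differentiable (by norm_num)
  have h1 : ∀ j, pderiv' j (fun y => φ (y i) * f y)
      = fun y => (if j = i then deriv φ (y i) else 0) * f y + φ (y i) * pderiv' j f y := by
    intro j; funext y
    rw [pd_mul j dc df, pd_coord i j dφ]
  have h2 : ∀ j, pderiv' j (pderiv' j (fun y => φ (y i) * f y)) x
      = φ (x i) * pderiv' j (pderiv' j f) x
        + if j = i then 2 * deriv φ (x i) * pderiv' i f x + deriv (deriv φ) (x i) * f x else 0 := by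
    intro j
    rw [h1]
    by_cases hj : j = i
    · subst hj
      simp only [if_true]
      rw [pd_add j (dc'.fun_mul df) (dc.fun_mul (hD j)), pd_mul j dc' df, pd_mul j dc (hD j),
        pd_coord j j dφ, pd_coord j j dφ']
      simp only [if_true]; ring
    · simp only [hj, if_false, zero_mul, zero_add, add_zero]
      rw [pd_mul j dc (hD j), pd_coord i j dφ]
      simp [hj]
  unfold lap
  rw [Finset.sum_congr rfl fun j _ => h2 j, Finset.sum_add_distrib, ← Finset.mul_sum]
  simp
  ring

theorem lap_pd {n : ℕ} (i : Fin n) {f : En n → ℝ} (hf : ContDiff ℝ 3 f) (x : En n) :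
    lap (pderiv' i f) x = pderiv' i (lap f) x := by
  have hD : ∀ j, ContDiff ℝ 2 (pderiv' j f) := fun j => pd_contDiff (m := 2) j hf
  have hDD : ∀ j, ContDiff ℝ 1 (pderiv' j (pderiv' j f)) := fun j => pd_contDiff (m := 1) j (hD j)
  unfold lap
  rw [pd_neg, pd_sum _ _ (fun j => (hDD j).differentiable (by norm_num))]
  congr 1
  refine Finset.sum_congr rfl fun j _ => ?_
  have : pderiv' j (pderiv' i f) = pderiv' i (pderiv' j f) :=
    funext fun y => pd_comm j i (hf.of_le (by norm_num)) y
  rw [this, pd_comm j i (hD j)]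

theorem integral_hess {n : ℕ} {g : En n → ℝ} (hg : ContDiff ℝ 3 g) (pg : ZPeriodic g) :
    ∑ i, ∑ j, ∫ x in unitCube n, (pderiv' i (pderiv' j g) x) ^ 2
      = ∫ x in unitCube n, (lap g x) ^ 2 := by
  have hD : ∀ j, ContDiff ℝ 2 (pderiv' j g) := fun j => pd_contDiff (m := 2) j hg
  have hL : ContDiff ℝ 1 (lap g) := lap_contDiff (m := 1) hg
  have h1 := integral_lap_grad hL (hg.of_le (by norm_num)) (lap_periodic pg) pg
  have h2 : ∀ j, ∫ x in unitCube n, pderiv' j (lap g) x * pderiv' j g x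
      = ∑ i, ∫ x in unitCube n, (pderiv' i (pderiv' j g) x) ^ 2 := by
    intro j
    have := integral_lap_grad ((hD j).of_le (by norm_num)) (hD j) (pd_periodic j pg)
      (pd_periodic j pg)
    simp only [pow_two]
    rw [← this]
    congr 1; funext x
    rw [lap_pd j hg]; ring
  rw [Finset.sum_comm]
  simp only [pow_two] at h2 ⊢
  rw [h1]
  exact Finset.sum_congr rfl fun j _ => (h2 j).symm

/-- The `L²` norm of `(Δ + a) g` controls the `H²` norm of `g`. -/
theorem integral_P_sq {n : ℕ} {g : En n → ℝ} (hg : ContDiff ℝ 3 g) (pg : ZPeriodic g) (a : ℝ) :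
    ∫ x in unitCube n, (lap g x + a * g x) ^ 2
      = ∑ i, ∑ j, (∫ x in unitCube n, (pderiv' i (pderiv' j g) x) ^ 2)
        + 2 * a * ∑ i, (∫ x in unitCube n, (pderiv' i g x) ^ 2)
        + a ^ 2 * ∫ x in unitCube n, (g x) ^ 2 := by
  have hL : Continuous (lap g) := (lap_contDiff (m := 1) hg).continuous
  have hc := hg.continuous
  have h1 := integral_lap_grad (hg.of_le (by norm_num)) (hg.of_le (by norm_num)) pg pg
  have e : ∀ x, (lap g x + a * g x) ^ 2
      = ((lap g x) ^ 2 + 2 * a * (g x * lap g x)) + a ^ 2 * (g x) ^ 2 := fun x => by ring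
  simp only [e]
  rw [I_add (by fun_prop) (by fun_prop), I_add (by fun_prop) (by fun_prop), I_smul, I_smul,
    integral_hess hg pg, h1]
  simp only [pow_two]

/-! ### Identities for solutions -/

/-- `u` is a positive periodic `C⁴` solution of `(Δ + a)² u = u^q`. -/
structure IsSol {n : ℕ} (a q : ℝ) (u : En n → ℝ) : Prop where
  smooth : ContDiff ℝ 4 u
  pos : ∀ x, 0 < u x
  per : ZPeriodic u
  eqn : ∀ x, lap (fun y => lap u y + a * u y) x + a * (lap u x + a * u x) = u x ^ q

namespace IsSol

variable {n : ℕ} {a q : ℝ} {u : En n → ℝ}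

theorem v_smooth (h : IsSol a q u) : ContDiff ℝ 2 (fun y => lap u y + a * u y) :=
  (lap_contDiff (m := 2) h.smooth).add (contDiff_const.mul (h.smooth.of_le (by norm_num)))

theorem v_per (h : IsSol a q u) : ZPeriodic (fun y => lap u y + a * u y) :=
  periodic_add (lap_periodic h.per) (periodic_comp h.per (fun t => a * t))

theorem rpow_contDiff (h : IsSol a q u) (r : ℝ) : ContDiff ℝ 4 (fun x => u x ^ r) :=
  h.smooth.rpow_const_of_ne (fun x => (h.pos x).ne')

theorem lap_cont (h : IsSol a q u) : Continuous (lap u) :=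
  (lap_contDiff (m := 2) h.smooth).continuous

theorem pd_smooth (h : IsSol a q u) (i : Fin n) : ContDiff ℝ 3 (pderiv' i u) :=
  pd_contDiff (m := 3) i h.smooth

theorem pd_cont (h : IsSol a q u) (i : Fin n) : Continuous (pderiv' i u) :=
  (h.pd_smooth i).continuous

theorem pdd_cont (h : IsSol a q u) (i : Fin n) : Continuous (pderiv' i (pderiv' i u)) :=
  (pd_contDiff (m := 2) i (h.pd_smooth i)).continuous

theorem test (h : IsSol a q u) {ζ : En n → ℝ} (hζ : ContDiff ℝ 2 ζ) (pζ : ZPeriodic ζ) :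
    ∫ x in unitCube n, (lap u x + a * u x) * (lap ζ x + a * ζ x)
      = ∫ x in unitCube n, ζ x * u x ^ q := by
  have hv := h.v_smooth
  have hs := integral_lap_symm hv hζ h.v_per pζ
  have c1 : Continuous (lap ζ) := (lap_contDiff (m := 0) hζ).continuous
  have c2 := hζ.continuous
  have c3 := h.lap_cont
  have c4 := h.smooth.continuous
  have c5 : Continuous (lap (fun y => lap u y + a * u y)) :=
    (lap_contDiff (m := 0) hv).continuous
  have e1 : ∀ x, (lap u x + a * u x) * (lap ζ x + a * ζ x)
      = (lap u x + a * u x) * lap ζ x + a * (ζ x * (lap u x + a * u x)) := fun x => by ring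
  have e2 : ∀ x, ζ x * u x ^ q
      = ζ x * lap (fun y => lap u y + a * u y) x + a * (ζ x * (lap u x + a * u x)) := fun x => by
    rw [← h.eqn x]; ring
  simp only [e1, e2]
  rw [I_add (by fun_prop) (by fun_prop), I_add (by fun_prop) (by fun_prop), hs]

theorem rpow_succ (h : IsSol a q u) (x : En n) : u x * u x ^ q = u x ^ (q + 1) := by
  rw [Real.rpow_add_one (h.pos x).ne']; ring

theorem energy (h : IsSol a q u) :
    ∫ x in unitCube n, (lap u x + a * u x) ^ 2 = ∫ x in unitCube n, u x ^ (q + 1) := by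
  have := h.test (h.smooth.of_le (by norm_num)) h.per
  simp only [pow_two]
  rw [this]
  simp only [h.rpow_succ]

theorem J_eq (h : IsSol a q u) :
    ∫ x in unitCube n, u x * (lap u x + a * u x)
      = (∑ i, ∫ x in unitCube n, (pderiv' i u x) ^ 2) + a * ∫ x in unitCube n, (u x) ^ 2 := by
  have h1 := integral_lap_grad (h.smooth.of_le (by norm_num)) (h.smooth.of_le (by norm_num))
    h.per h.per
  have c3 := h.lap_cont
  have c4 := h.smooth.continuous
  have e1 : ∀ x, u x * (lap u x + a * u x) = u x * lap u x + a * (u x) ^ 2 := fun x => by ring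
  simp only [e1]
  rw [I_add (by fun_prop) (by fun_prop), h1, I_smul]
  simp only [pow_two]

/-- Pohozaev identity with the vector field `φ(xᵢ) eᵢ` whose derivative is `1 - ψ`. -/
theorem pohozaev_coord (h : IsSol a q u) (hq : 0 < q + 1) (i : Fin n) {φ ψ : ℝ → ℝ}
    (hφ : ContDiff ℝ 3 φ) (pφ : Function.Periodic φ 1) (hψ : ContDiff ℝ 2 ψ)
    (hd : deriv φ = fun t => 1 - ψ t) :
    - (1 / 2) * ((∫ x in unitCube n, (lap u x + a * u x) ^ 2)
        - ∫ x in unitCube n, ψ (x i) * (lap u x + a * u x) ^ 2)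
      + (∫ x in unitCube n, deriv ψ (x i) * (lap u x + a * u x) * pderiv' i u x)
      - 2 * (∫ x in unitCube n, (lap u x + a * u x) * pderiv' i (pderiv' i u) x)
      + 2 * (∫ x in unitCube n, ψ (x i) * (lap u x + a * u x) * pderiv' i (pderiv' i u) x)
    = - (1 / (q + 1)) * ((∫ x in unitCube n, u x ^ (q + 1))
        - ∫ x in unitCube n, ψ (x i) * u x ^ (q + 1)) := by
  have dψ : Differentiable ℝ ψ := hψ.differentiable (by norm_num)
  have hdd : deriv (deriv φ) = fun t => - deriv ψ t := by
    rw [hd]; funext t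
    rw [deriv_const_sub]
  have hψ' : ContDiff ℝ 1 (deriv ψ) := by
    have := (contDiff_succ_iff_deriv (n := 1) (f := ψ) (𝕜 := ℝ)).1
      (by simpa [one_add_one_eq_two] using hψ)
    exact this.2.2
  set v : En n → ℝ := fun y => lap u y + a * u y with hvdef
  have hv : ContDiff ℝ 2 v := h.v_smooth
  have pv : ZPeriodic v := h.v_per
  have cφ : ContDiff ℝ 3 (fun x : En n => φ (x i)) := contDiff_coord i hφ
  have pcφ : ZPeriodic (fun x : En n => φ (x i)) := periodic_coord i pφ
  have dφ : Differentiable ℝ φ := hφ.differentiable (by norm_num)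
  have ht := h.test (ζ := fun x => φ (x i) * pderiv' i u x)
    ((cφ.mul (h.pd_smooth i)).of_le (by norm_num)) (periodic_mul pcφ (pd_periodic i h.per))
  -- compute `P (φ ∂ᵢ u)`
  have hP : ∀ x, lap (fun x => φ (x i) * pderiv' i u x) x + a * (φ (x i) * pderiv' i u x)
      = φ (x i) * pderiv' i v x + deriv ψ (x i) * pderiv' i u x
        - 2 * (1 - ψ (x i)) * pderiv' i (pderiv' i u) x := by
    intro x
    rw [lap_coord_mul i (hφ.of_le (by norm_num)) ((h.pd_smooth i).of_le (by norm_num)),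
      lap_pd i (h.smooth.of_le (by norm_num)), hdd, hd, hvdef,
      pd_add i ((lap_contDiff (m := 2) h.smooth).differentiable (by norm_num))
        ((h.smooth.differentiable (by norm_num)).const_mul a),
      pd_const_mul i a (h.smooth.differentiable (by norm_num))]
    ring
  -- total derivatives
  have t1 := integral_pd i (F := fun x => φ (x i) * (v x * v x))
    ((cφ.of_le (by norm_num)).mul ((hv.mul hv).of_le (by norm_num)))
    (periodic_mul pcφ (periodic_mul pv pv))
  have t2 := integral_pd i (F := fun x => φ (x i) * u x ^ (q + 1))
    ((cφ.of_le (by norm_num)).mul ((h.rpow_contDiff (q + 1)).of_le (by norm_num)))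
    (periodic_mul pcφ (periodic_comp h.per (fun t => t ^ (q + 1))))
  have dv : Differentiable ℝ v := hv.differentiable (by norm_num)
  have du : Differentiable ℝ u := h.smooth.differentiable (by norm_num)
  have dcφ : Differentiable ℝ (fun x : En n => φ (x i)) := cφ.differentiable (by norm_num)
  have e1 : ∀ x, pderiv' i (fun x => φ (x i) * (v x * v x)) x
      = v x ^ 2 - ψ (x i) * v x ^ 2 + 2 * (φ (x i) * v x * pderiv' i v x) := by
    intro x
    rw [pd_mul i dcφ (dv.fun_mul dv), pd_mul i dv dv, pd_coord i i dφ, hd]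
    simp only [if_true]; ring
  have e2 : ∀ x, pderiv' i (fun x => φ (x i) * u x ^ (q + 1)) x
      = u x ^ (q + 1) - ψ (x i) * u x ^ (q + 1)
        + (q + 1) * (φ (x i) * pderiv' i u x * u x ^ q) := by
    intro x
    rw [pd_mul i dcφ ((h.rpow_contDiff (q + 1)).differentiable (by norm_num)),
      pd_rpow i (q + 1) du h.pos, pd_coord i i dφ, hd]
    simp only [if_true, add_sub_cancel_right]; ring
  simp only [e1] at t1
  simp only [e2] at t2
  have k1 : Continuous v := hv.continuous
  have k2 : Continuous (fun x : En n => φ (x i)) := cφ.continuous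
  have k3 : Continuous (fun x : En n => ψ (x i)) := (contDiff_coord i hψ).continuous
  have k4 : Continuous (fun x : En n => deriv ψ (x i)) := (contDiff_coord i hψ').continuous
  have k5 := h.pd_cont i
  have k6 := h.pdd_cont i
  have k7 : Continuous (pderiv' i v) := (pd_contDiff (m := 1) i hv).continuous
  have k8 := (h.rpow_contDiff (q + 1)).continuous
  have k9 := (h.rpow_contDiff q).continuous
  rw [I_add (by fun_prop) (by fun_prop), I_sub (by fun_prop) (by fun_prop), I_smul] at t1 t2
  simp only [hP] at ht
  have e3 : ∀ x, v x * (φ (x i) * pderiv' i v x + deriv ψ (x i) * pderiv' i u x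
        - 2 * (1 - ψ (x i)) * pderiv' i (pderiv' i u) x)
      = φ (x i) * v x * pderiv' i v x + deriv ψ (x i) * v x * pderiv' i u x
        - 2 * (v x * pderiv' i (pderiv' i u) x)
        + 2 * (ψ (x i) * v x * pderiv' i (pderiv' i u) x) := fun x => by ring
  have ht' : ∫ x in unitCube n, v x * (φ (x i) * pderiv' i v x + deriv ψ (x i) * pderiv' i u x
        - 2 * (1 - ψ (x i)) * pderiv' i (pderiv' i u) x)
      = ∫ x in unitCube n, φ (x i) * pderiv' i u x * u x ^ q := ht
  simp only [e3] at ht'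
  rw [I_add (by fun_prop) (by fun_prop), I_sub (by fun_prop) (by fun_prop),
    I_add (by fun_prop) (by fun_prop), I_smul, I_smul] at ht'
  change - (1 / 2) * ((∫ x in unitCube n, v x ^ 2) - ∫ x in unitCube n, ψ (x i) * v x ^ 2)
      + (∫ x in unitCube n, deriv ψ (x i) * v x * pderiv' i u x)
      - 2 * (∫ x in unitCube n, v x * pderiv' i (pderiv' i u) x)
      + 2 * (∫ x in unitCube n, ψ (x i) * v x * pderiv' i (pderiv' i u) x) = _
  have t3 : ∫ x in unitCube n, φ (x i) * pderiv' i u x * u x ^ q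
      = - (1 / (q + 1)) * ((∫ x in unitCube n, u x ^ (q + 1))
        - ∫ x in unitCube n, ψ (x i) * u x ^ (q + 1)) := by
    field_simp
    linarith
  rw [← t3]
  linarith

end IsSol

namespace IsSol

variable {n : ℕ} {a q : ℝ} {u : En n → ℝ}

/-- Summed Pohozaev identity. -/
theorem pohozaev (h : IsSol a q u) (hq : 0 < q + 1) (hnq : (n : ℝ) / (q + 1) = (n : ℝ) / 2 - 2)
    {φ ψ : Fin n → ℝ → ℝ}
    (hφ : ∀ i, ContDiff ℝ 3 (φ i)) (pφ : ∀ i, Function.Periodic (φ i) 1)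
    (hψ : ∀ i, ContDiff ℝ 2 (ψ i))
    (hd : ∀ i, deriv (φ i) = fun t => 1 - ψ i t) :
    2 * a * (∫ x in unitCube n, u x * (lap u x + a * u x))
    = ∑ i, ((1 / 2) * (∫ x in unitCube n, ψ i (x i) * (lap u x + a * u x) ^ 2)
      - (1 / (q + 1)) * (∫ x in unitCube n, ψ i (x i) * u x ^ (q + 1))
      + (∫ x in unitCube n, deriv (ψ i) (x i) * (lap u x + a * u x) * pderiv' i u x)
      + 2 * (∫ x in unitCube n, ψ i (x i) * (lap u x + a * u x) * pderiv' i (pderiv' i u) x)) := by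
  have hi := fun i => h.pohozaev_coord hq i (hφ i) (pφ i) (hψ i) (hd i)
  have hE := h.energy
  set E := ∫ x in unitCube n, u x ^ (q + 1) with hEdef
  have hsum : ∑ i, ((1 / 2) * (∫ x in unitCube n, ψ i (x i) * (lap u x + a * u x) ^ 2)
      - (1 / (q + 1)) * (∫ x in unitCube n, ψ i (x i) * u x ^ (q + 1))
      + (∫ x in unitCube n, deriv (ψ i) (x i) * (lap u x + a * u x) * pderiv' i u x)
      + 2 * (∫ x in unitCube n, ψ i (x i) * (lap u x + a * u x) * pderiv' i (pderiv' i u) x))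
      = ∑ i : Fin n, ((1 / 2 - 1 / (q + 1)) * E
        + 2 * ∫ x in unitCube n, (lap u x + a * u x) * pderiv' i (pderiv' i u) x) := by
    refine Finset.sum_congr rfl fun i _ => ?_
    have := hi i
    rw [hE] at this
    linarith
  have c3 := h.lap_cont
  have c4 := h.smooth.continuous
  have hl : ∫ x in unitCube n, (lap u x + a * u x) * lap u x
      = - ∑ i, ∫ x in unitCube n, (lap u x + a * u x) * pderiv' i (pderiv' i u) x := by
    rw [← I_sum, ← integral_neg]
    · congr 1; funext x
      rw [← Finset.mul_sum, ← mul_neg]; rfl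
    · intro i
      have := h.pdd_cont i
      fun_prop
  have hl2 : ∫ x in unitCube n, (lap u x + a * u x) * lap u x
      = E - a * ∫ x in unitCube n, u x * (lap u x + a * u x) := by
    rw [← hE, ← I_smul, ← I_sub (by fun_prop) (by fun_prop)]
    congr 1; funext x; ring
  rw [hsum, Finset.sum_add_distrib]
  simp only [Finset.sum_const, Finset.card_univ, Fintype.card_fin, nsmul_eq_mul]
  rw [← Finset.mul_sum]
  have h0 : (n : ℝ) * ((1 / 2 - 1 / (q + 1)) * E) = 2 * E := by
    have : (n : ℝ) * ((1 / 2 - 1 / (q + 1)) * E) = ((n : ℝ) / 2 - n / (q + 1)) * E := by ring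
    rw [this, hnq]; ring
  linarith

theorem J_bounds (h : IsSol a q u) (ha : 1 ≤ a) :
    (∫ x in unitCube n, (u x) ^ 2) ≤ (∫ x in unitCube n, u x * (lap u x + a * u x)) ∧
    ∀ i, (∫ x in unitCube n, (pderiv' i u x) ^ 2)
      ≤ ∫ x in unitCube n, u x * (lap u x + a * u x) := by
  rw [h.J_eq]
  have h0 : ∀ i : Fin n, 0 ≤ ∫ x in unitCube n, (pderiv' i u x) ^ 2 :=
    fun i => I_nonneg fun x => sq_nonneg _
  have h1 : 0 ≤ ∫ x in unitCube n, (u x) ^ 2 := I_nonneg fun x => sq_nonneg _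
  constructor
  · have := Finset.sum_nonneg (fun i (_ : i ∈ Finset.univ) => h0 i)
    nlinarith
  · intro i
    have := Finset.single_le_sum (fun i _ => h0 i) (Finset.mem_univ i)
    nlinarith

/-- Local (slab) estimate. -/
theorem local_estimate (h : IsSol a q u) (ha : 1 ≤ a) (i : Fin n) {θ : ℝ → ℝ} {M : ℝ}
    (hθ : ContDiff ℝ 3 θ) (pθ : Function.Periodic θ 1)
    (b1 : ∀ t, |deriv θ t| ≤ M) (b2 : ∀ t, |deriv (deriv θ) t| ≤ M)
    (b3 : ∀ t, |deriv (deriv (fun s => θ s ^ 2)) t| ≤ M * |θ t|)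
    (hS : 12 * ∫ x in unitCube n, θ (x i) ^ 2 * u x ^ (q + 1)
      ≤ ∫ x in unitCube n, (lap (fun y => θ (y i) * u y) x + a * (θ (x i) * u x)) ^ 2) :
    (∫ x in unitCube n, θ (x i) ^ 2 * (lap u x + a * u x) ^ 2)
      ≤ 74 * M ^ 2 * (∫ x in unitCube n, u x * (lap u x + a * u x)) ∧
    (∫ x in unitCube n, θ (x i) ^ 2 * (pderiv' i (pderiv' i u) x) ^ 2)
      ≤ 726 * M ^ 2 * (∫ x in unitCube n, u x * (lap u x + a * u x)) := by
  obtain ⟨hJ0, hJ1⟩ := h.J_bounds ha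
  replace hJ1 := hJ1 i
  set J := ∫ x in unitCube n, u x * (lap u x + a * u x) with hJ
  set v : En n → ℝ := fun y => lap u y + a * u y with hvdef
  have hv : ContDiff ℝ 2 v := h.v_smooth
  have dθ : Differentiable ℝ θ := hθ.differentiable (by norm_num)
  have hθ1 : ContDiff ℝ 2 (deriv θ) := by
    have := (contDiff_succ_iff_deriv (n := 2) (f := θ) (𝕜 := ℝ)).1
      (by simpa [show (2 : WithTop ℕ∞) + 1 = 3 by norm_num] using hθ)
    exact this.2.2
  have hθ2 : ContDiff ℝ 1 (deriv (deriv θ)) := by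
    have := (contDiff_succ_iff_deriv (n := 1) (f := deriv θ) (𝕜 := ℝ)).1
      (by simpa [one_add_one_eq_two] using hθ1)
    exact this.2.2
  have hs1 : deriv (fun s => θ s ^ 2) = fun s => 2 * θ s * deriv θ s := by
    funext s
    have := ((dθ s).hasDerivAt.fun_pow 2).deriv
    simpa using this
  have hsq : ContDiff ℝ 2 (fun s => θ s ^ 2) := (hθ.pow 2).of_le (by norm_num)
  have hsq2 : Continuous (deriv (deriv (fun s => θ s ^ 2))) := by
    rw [hs1]
    have : ContDiff ℝ 1 (fun s => 2 * θ s * deriv θ s) :=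
      (contDiff_const.mul (hθ.of_le (by norm_num))).mul (hθ1.of_le (by norm_num))
    have := (contDiff_succ_iff_deriv (n := 0) (f := (fun s => 2 * θ s * deriv θ s)) (𝕜 := ℝ)).1
      (by simpa using this)
    exact this.2.2.continuous
  -- continuity facts
  have k1 : Continuous v := hv.continuous
  have k2 : Continuous (fun x : En n => θ (x i)) := (contDiff_coord i hθ).continuous
  have k3 : Continuous (fun x : En n => deriv θ (x i)) := (contDiff_coord i hθ1).continuous
  have k4 : Continuous (fun x : En n => deriv (deriv θ) (x i)) :=
    (contDiff_coord i hθ2).continuous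
  have k4' : Continuous (fun x : En n => deriv (deriv (fun s => θ s ^ 2)) (x i)) :=
    hsq2.comp (EuclideanSpace.proj i : En n →L[ℝ] ℝ).continuous
  have k5 := h.pd_cont i
  have k6 := h.pdd_cont i
  have k8 := (h.rpow_contDiff (q + 1)).continuous
  have k9 := h.smooth.continuous
  -- names for the integrals
  set A := ∫ x in unitCube n, θ (x i) ^ 2 * v x ^ 2 with hA
  set T := ∫ x in unitCube n, θ (x i) ^ 2 * u x ^ (q + 1) with hT
  have hM : 0 ≤ M := (abs_nonneg _).trans (b1 0)
  have hM2 : 0 ≤ M ^ 2 := sq_nonneg M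
  have hu2 : 0 ≤ ∫ x in unitCube n, (u x) ^ 2 := I_nonneg fun x => sq_nonneg _
  have hJpos : 0 ≤ J := hu2.trans hJ0
  -- `P g`
  have hu2s : ContDiff ℝ 2 u := h.smooth.of_le (by norm_num)
  have hPg : ∀ x, lap (fun y => θ (y i) * u y) x + a * (θ (x i) * u x)
      = θ (x i) * v x - 2 * deriv θ (x i) * pderiv' i u x - deriv (deriv θ) (x i) * u x := by
    intro x
    rw [lap_coord_mul i (hθ.of_le (by norm_num)) hu2s]
    simp only [hvdef]; ring
  have cPg : Continuous (fun x => lap (fun y => θ (y i) * u y) x + a * (θ (x i) * u x)) := by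
    simp only [hPg]; fun_prop
  set B := ∫ x in unitCube n, (lap (fun y => θ (y i) * u y) x + a * (θ (x i) * u x)) ^ 2 with hB
  have sqb : ∀ {s : ℝ}, |s| ≤ M → s ^ 2 ≤ M ^ 2 := fun hs => sq_le_sq' (abs_le.1 hs).1 (abs_le.1 hs).2
  have hBle : B ≤ 3 * A + 15 * M ^ 2 * J := by
    have : B ≤ ∫ x in unitCube n, (3 * (θ (x i) ^ 2 * v x ^ 2)
        + 12 * M ^ 2 * (pderiv' i u x) ^ 2 + 3 * M ^ 2 * (u x) ^ 2) := by
      refine I_mono (cPg.pow 2) (by fun_prop) fun x => ?_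
      rw [hPg]
      have s1 := mul_le_mul_of_nonneg_right (sqb (b1 (x i))) (sq_nonneg (pderiv' i u x))
      have s2 := mul_le_mul_of_nonneg_right (sqb (b2 (x i))) (sq_nonneg (u x))
      have s3 : ∀ p q r : ℝ, (p - q - r) ^ 2 ≤ 3 * (p ^ 2 + q ^ 2 + r ^ 2) := fun p q r => by
        nlinarith [sq_nonneg (p + q), sq_nonneg (p + r), sq_nonneg (q - r)]
      have s4 := s3 (θ (x i) * v x) (2 * deriv θ (x i) * pderiv' i u x)
        (deriv (deriv θ) (x i) * u x)
      simp only [mul_pow] at s4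
      linarith
    rw [I_add (by fun_prop) (by fun_prop), I_add (by fun_prop) (by fun_prop), I_smul, I_smul,
      I_smul] at this
    have m1 := mul_le_mul_of_nonneg_left hJ0 hM2
    have m2 := mul_le_mul_of_nonneg_left hJ1 hM2
    nlinarith
  -- Caccioppoli
  have hAle : A ≤ 2 * T + 34 * M ^ 2 * J := by
    have ht := h.test (ζ := fun x => (fun s => θ s ^ 2) (x i) * u x)
      ((contDiff_coord i hsq).mul hu2s)
      (periodic_mul (periodic_coord i (φ := fun s => θ s ^ 2)
        (fun s => by simp only [pθ s])) h.per)
    have hP2 : ∀ x, (lap u x + a * u x) * (lap (fun x => (fun s => θ s ^ 2) (x i) * u x) x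
          + a * ((fun s => θ s ^ 2) (x i) * u x))
        = θ (x i) ^ 2 * v x ^ 2 - (4 * θ (x i) * deriv θ (x i) * pderiv' i u x * v x
          + deriv (deriv (fun s => θ s ^ 2)) (x i) * u x * v x) := by
      intro x
      rw [lap_coord_mul i hsq hu2s]
      rw [show deriv (fun s => θ s ^ 2) (x i) = 2 * θ (x i) * deriv θ (x i) from congrFun hs1 _]
      simp only [hvdef]; ring
    have hR : ∀ x, (fun s => θ s ^ 2) (x i) * u x * u x ^ q = θ (x i) ^ 2 * u x ^ (q + 1) := by
      intro x; rw [← h.rpow_succ x]; ring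
    simp only [hP2] at ht
    simp only [hR] at ht
    rw [I_sub (by fun_prop) (by fun_prop)] at ht
    set L := ∫ x in unitCube n, (4 * θ (x i) * deriv θ (x i) * pderiv' i u x * v x
          + deriv (deriv (fun s => θ s ^ 2)) (x i) * u x * v x) with hL
    have : L
        ≤ ∫ x in unitCube n, ((1 / 2) * (θ (x i) ^ 2 * v x ^ 2)
          + 16 * M ^ 2 * (pderiv' i u x) ^ 2 + M ^ 2 * (u x) ^ 2) := by
      refine I_mono (by fun_prop) (by fun_prop) fun x => ?_
      have s1 := mul_le_mul_of_nonneg_right (sqb (b1 (x i))) (sq_nonneg (pderiv' i u x))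
      have s2 : deriv (deriv (fun s => θ s ^ 2)) (x i) * u x * v x
          ≤ (1 / 4) * (θ (x i) ^ 2 * v x ^ 2) + M ^ 2 * (u x) ^ 2 := by
        calc deriv (deriv (fun s => θ s ^ 2)) (x i) * u x * v x
            ≤ |deriv (deriv (fun s => θ s ^ 2)) (x i) * u x * v x| := le_abs_self _
          _ = |deriv (deriv (fun s => θ s ^ 2)) (x i)| * (|u x| * |v x|) := by
              rw [abs_mul, abs_mul, mul_assoc]
          _ ≤ (M * |θ (x i)|) * (|u x| * |v x|) :=
              mul_le_mul_of_nonneg_right (b3 (x i)) (by positivity)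
          _ ≤ (1 / 4) * (|θ (x i)| ^ 2 * |v x| ^ 2) + M ^ 2 * |u x| ^ 2 := by
              nlinarith [sq_nonneg (|θ (x i)| * |v x| / 2 - M * |u x|)]
          _ = _ := by simp only [sq_abs]
      nlinarith [sq_nonneg (θ (x i) * v x / 2 - 4 * deriv θ (x i) * pderiv' i u x)]
    rw [I_add (by fun_prop) (by fun_prop), I_add (by fun_prop) (by fun_prop), I_smul, I_smul,
      I_smul] at this
    have m1 := mul_le_mul_of_nonneg_left hJ0 hM2
    have m2 := mul_le_mul_of_nonneg_left hJ1 hM2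
    nlinarith
  have hMJ : 0 ≤ M ^ 2 * J := mul_nonneg hM2 hJpos
  have hA74 : A ≤ 74 * M ^ 2 * J := by linarith
  refine ⟨hA74, ?_⟩
  have hB2 : B ≤ 237 * M ^ 2 * J := by linarith
  -- second derivatives
  have hg3 : ContDiff ℝ 3 (fun y : En n => θ (y i) * u y) :=
    (contDiff_coord i hθ).mul (h.smooth.of_le (by norm_num))
  have hBeq := integral_P_sq hg3 (periodic_mul (periodic_coord i pθ) h.per) a
  have hii : ∫ x in unitCube n, (pderiv' i (pderiv' i (fun y : En n => θ (y i) * u y)) x) ^ 2 ≤ B := by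
    rw [hB, hBeq]
    have n1 : ∀ k l : Fin n, 0 ≤ ∫ x in unitCube n,
        (pderiv' k (pderiv' l (fun y : En n => θ (y i) * u y)) x) ^ 2 :=
      fun k l => I_nonneg fun x => sq_nonneg _
    have n2 : 0 ≤ ∑ k, ∫ x in unitCube n, (pderiv' k (fun y : En n => θ (y i) * u y) x) ^ 2 :=
      Finset.sum_nonneg fun k _ => I_nonneg fun x => sq_nonneg _
    have n3 : 0 ≤ ∫ x in unitCube n, (θ (x i) * u x) ^ 2 := I_nonneg fun x => sq_nonneg _
    have n4 := Finset.single_le_sum (fun l _ => n1 i l) (Finset.mem_univ i)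
    have n5 := Finset.single_le_sum
      (fun k (_ : k ∈ Finset.univ) => Finset.sum_nonneg fun l (_ : l ∈ Finset.univ) => n1 k l)
      (Finset.mem_univ i)
    have n6 : 0 ≤ 2 * a * ∑ k, ∫ x in unitCube n,
      (pderiv' k (fun y : En n => θ (y i) * u y) x) ^ 2 := mul_nonneg (by linarith) n2
    have n7 : 0 ≤ a ^ 2 * ∫ x in unitCube n, (θ (x i) * u x) ^ 2 := mul_nonneg (sq_nonneg _) n3
    linarith
  have cii : Continuous (pderiv' i (pderiv' i (fun y : En n => θ (y i) * u y))) :=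
    (pd_contDiff (m := 1) i (pd_contDiff (m := 2) i hg3)).continuous
  have eii : ∀ x, pderiv' i (pderiv' i (fun y : En n => θ (y i) * u y)) x
      = θ (x i) * pderiv' i (pderiv' i u) x + 2 * deriv θ (x i) * pderiv' i u x
        + deriv (deriv θ) (x i) * u x := by
    intro x
    have du : Differentiable ℝ u := h.smooth.differentiable (by norm_num)
    have dpu : Differentiable ℝ (pderiv' i u) := (h.pd_smooth i).differentiable (by norm_num)
    have dc : Differentiable ℝ (fun y : En n => θ (y i)) :=
      (contDiff_coord i hθ).differentiable (by norm_num)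
    have dc' : Differentiable ℝ (fun y : En n => deriv θ (y i)) :=
      (contDiff_coord i hθ1).differentiable (by norm_num)
    have e1 : pderiv' i (fun y : En n => θ (y i) * u y)
        = fun y => deriv θ (y i) * u y + θ (y i) * pderiv' i u y := by
      funext y
      rw [pd_mul i dc du, pd_coord i i dθ]; simp
    rw [e1, pd_add i (dc'.fun_mul du) (dc.fun_mul dpu), pd_mul i dc' du, pd_mul i dc dpu,
      pd_coord i i dθ, pd_coord i i (hθ1.differentiable (by norm_num))]
    simp only [if_true]; ring
  have : ∫ x in unitCube n, θ (x i) ^ 2 * (pderiv' i (pderiv' i u) x) ^ 2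
      ≤ ∫ x in unitCube n, (3 * (pderiv' i (pderiv' i (fun y : En n => θ (y i) * u y)) x) ^ 2
        + 12 * M ^ 2 * (pderiv' i u x) ^ 2 + 3 * M ^ 2 * (u x) ^ 2) := by
    refine I_mono (by fun_prop) (by fun_prop) fun x => ?_
    have s1 := mul_le_mul_of_nonneg_right (sqb (b1 (x i))) (sq_nonneg (pderiv' i u x))
    have s2 := mul_le_mul_of_nonneg_right (sqb (b2 (x i))) (sq_nonneg (u x))
    have s3 : ∀ p q r : ℝ, (p - q - r) ^ 2 ≤ 3 * (p ^ 2 + q ^ 2 + r ^ 2) := fun p q r => by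
      nlinarith [sq_nonneg (p + q), sq_nonneg (p + r), sq_nonneg (q - r)]
    have s4 := s3 (pderiv' i (pderiv' i (fun y : En n => θ (y i) * u y)) x)
      (2 * deriv θ (x i) * pderiv' i u x) (deriv (deriv θ) (x i) * u x)
    have s5 : pderiv' i (pderiv' i (fun y : En n => θ (y i) * u y)) x
        - 2 * deriv θ (x i) * pderiv' i u x - deriv (deriv θ) (x i) * u x
        = θ (x i) * pderiv' i (pderiv' i u) x := by rw [eii]; ring
    rw [s5] at s4
    simp only [mul_pow] at s4
    linarith
  rw [I_add (by fun_prop) (by fun_prop), I_add (by fun_prop) (by fun_prop), I_smul, I_smul,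
    I_smul] at this
  have m1 := mul_le_mul_of_nonneg_left hJ0 hM2
  have m2 := mul_le_mul_of_nonneg_left hJ1 hM2
  nlinarith

end IsSol

/-! ### Sobolev inequality on the torus -/

theorem opNorm_le_sum {n : ℕ} {F : Type*} [NormedAddCommGroup F] [NormedSpace ℝ F]
    (L : En n →L[ℝ] F) : ‖L‖ ≤ ∑ i, ‖L (EuclideanSpace.single i 1)‖ := by
  refine L.opNorm_le_bound (Finset.sum_nonneg fun i _ => norm_nonneg _) fun x => ?_
  have hx : x = ∑ i, x i • (EuclideanSpace.single i (1 : ℝ) : En n) := by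
    ext j
    simp [Finset.sum_apply, Pi.single_apply]
  calc ‖L x‖ = ‖∑ i, x i • L (EuclideanSpace.single i 1)‖ := by
        conv_lhs => rw [hx]
        simp
    _ ≤ ∑ i, ‖x i • L (EuclideanSpace.single i 1)‖ := norm_sum_le _ _
    _ ≤ ∑ i, ‖L (EuclideanSpace.single i 1)‖ * ‖x‖ := by
        refine Finset.sum_le_sum fun i _ => ?_
        rw [norm_smul, mul_comm]
        exact mul_le_mul_of_nonneg_left (PiLp.norm_apply_le x i) (norm_nonneg _)
    _ = _ := by rw [Finset.sum_mul]

theorem norm_fderiv_le_pd {n : ℕ} (g : En n → ℝ) (x : En n) :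
    ‖fderiv ℝ g x‖ ≤ ∑ i, |pderiv' i g x| := opNorm_le_sum _

theorem norm_fderiv2_le_pd {n : ℕ} {g : En n → ℝ} (hg : ContDiff ℝ 2 g) (x : En n) :
    ‖fderiv ℝ (fderiv ℝ g) x‖ ≤ ∑ i, ∑ j, |pderiv' i (pderiv' j g) x| := by
  refine (opNorm_le_sum _).trans (Finset.sum_le_sum fun i _ => ?_)
  refine (opNorm_le_sum _).trans (Finset.sum_le_sum fun j _ => ?_)
  have hd : Differentiable ℝ (fderiv ℝ g) :=
    (hg.fderiv_right (m := 1) (by norm_num)).differentiable (by norm_num)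
  unfold pderiv'
  have := ((hd x).hasFDerivAt.clm_apply
    (hasFDerivAt_const (EuclideanSpace.single j (1 : ℝ) : En n) x)).fderiv
  rw [this]; simp

/-- The `H²` density. -/
def hDens {n : ℕ} (g : En n → ℝ) (x : En n) : ℝ :=
  (∑ i, ∑ j, (pderiv' i (pderiv' j g) x) ^ 2) + (∑ i, (pderiv' i g x) ^ 2) + g x ^ 2

theorem hDens_nonneg {n : ℕ} (g : En n → ℝ) (x : En n) : 0 ≤ hDens g x := by
  unfold hDens
  have h1 : 0 ≤ ∑ i, ∑ j, (pderiv' i (pderiv' j g) x) ^ 2 :=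
    Finset.sum_nonneg fun i _ => Finset.sum_nonneg fun j _ => sq_nonneg _
  have h2 : 0 ≤ ∑ i, (pderiv' i g x) ^ 2 := Finset.sum_nonneg fun i _ => sq_nonneg _
  positivity

theorem hDens_per {n : ℕ} {g : En n → ℝ} (pg : ZPeriodic g) : ZPeriodic (hDens g) := by
  intro x k
  unfold hDens
  simp only [pg x k, pd_periodic _ pg x k, pd_periodic _ (pd_periodic _ pg) x k]

theorem hDens_cont {n : ℕ} {g : En n → ℝ} (hg : ContDiff ℝ 2 g) : Continuous (hDens g) := by
  unfold hDens
  have h1 : ∀ i, ContDiff ℝ 1 (pderiv' i g) := fun i => pd_contDiff (m := 1) i hg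
  have h2 : ∀ i j, Continuous (pderiv' i (pderiv' j g)) := fun i j =>
    (pd_contDiff (m := 0) i (h1 j)).continuous
  have h3 : ∀ i, Continuous (pderiv' i g) := fun i => (h1 i).continuous
  refine ((continuous_finsetSum _ fun i _ => continuous_finsetSum _ fun j _ => (h2 i j).pow 2).add
    (continuous_finsetSum _ fun i _ => (h3 i).pow 2)).add (hg.continuous.pow 2)

theorem hDens_bound {n : ℕ} {g : En n → ℝ} (hg : ContDiff ℝ 2 g) (x : En n) :
    (|g x| + ‖fderiv ℝ g x‖ + ‖fderiv ℝ (fderiv ℝ g) x‖) ^ 2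
      ≤ 3 * (1 + n + (n : ℝ) ^ 2) * hDens g x := by
  have a1 : ‖fderiv ℝ g x‖ ^ 2 ≤ n * ∑ i, (pderiv' i g x) ^ 2 := by
    have h1 := pow_le_pow_left₀ (norm_nonneg _) (norm_fderiv_le_pd g x) 2
    have h2 := sq_sum_le_card_mul_sum_sq (s := Finset.univ) (f := fun i => |pderiv' i g x|)
    simp only [sq_abs, Finset.card_univ, Fintype.card_fin] at h2
    exact h1.trans h2
  have a2 : ‖fderiv ℝ (fderiv ℝ g) x‖ ^ 2
      ≤ (n : ℝ) ^ 2 * ∑ i, ∑ j, (pderiv' i (pderiv' j g) x) ^ 2 := by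
    have h1 := pow_le_pow_left₀ (norm_nonneg (fderiv ℝ (fderiv ℝ g) x))
      (norm_fderiv2_le_pd hg x) 2
    have h2 := sq_sum_le_card_mul_sum_sq (s := Finset.univ)
      (f := fun i => ∑ j, |pderiv' i (pderiv' j g) x|)
    have h3 : ∀ i, (∑ j, |pderiv' i (pderiv' j g) x|) ^ 2
        ≤ n * ∑ j, (pderiv' i (pderiv' j g) x) ^ 2 := by
      intro i
      have h2 := sq_sum_le_card_mul_sum_sq (s := Finset.univ)
        (f := fun j => |pderiv' i (pderiv' j g) x|)
      simpa only [sq_abs, Finset.card_univ, Fintype.card_fin] using h2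
    simp only [Finset.card_univ, Fintype.card_fin] at h2
    have h4 := Finset.sum_le_sum (s := Finset.univ) (fun i _ => h3 i)
    rw [← Finset.mul_sum] at h4
    have h5 := mul_le_mul_of_nonneg_left h4 (Nat.cast_nonneg (α := ℝ) n)
    calc _ ≤ _ := h1
      _ ≤ _ := h2
      _ ≤ _ := h5
      _ = _ := by ring
  have h1 : 0 ≤ ∑ i, ∑ j, (pderiv' i (pderiv' j g) x) ^ 2 :=
    Finset.sum_nonneg fun i _ => Finset.sum_nonneg fun j _ => sq_nonneg _
  have h2 : 0 ≤ ∑ i, (pderiv' i g x) ^ 2 := Finset.sum_nonneg fun i _ => sq_nonneg _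
  unfold hDens
  set X := ∑ i, ∑ j, (pderiv' i (pderiv' j g) x) ^ 2
  set Y := ∑ i, (pderiv' i g x) ^ 2
  have h3 : ∀ p q r : ℝ, (p + q + r) ^ 2 ≤ 3 * (p ^ 2 + q ^ 2 + r ^ 2) := fun p q r => by
    nlinarith [sq_nonneg (p - q), sq_nonneg (p - r), sq_nonneg (q - r)]
  have h4 := h3 (|g x|) (‖fderiv ℝ g x‖) (‖fderiv ℝ (fderiv ℝ g) x‖)
  rw [sq_abs] at h4
  have h5 : (0 : ℝ) ≤ n := Nat.cast_nonneg n
  have h6 : 0 ≤ g x ^ 2 := sq_nonneg _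
  have : g x ^ 2 + n * Y + (n : ℝ) ^ 2 * X ≤ (1 + n + (n : ℝ) ^ 2) * (X + Y + g x ^ 2) := by
    have e1 : 0 ≤ (n : ℝ) * X := by positivity
    have e2 : 0 ≤ (n : ℝ) * g x ^ 2 := by positivity
    have e3 : 0 ≤ (n : ℝ) ^ 2 * Y := by positivity
    have e4 : 0 ≤ (n : ℝ) ^ 2 * g x ^ 2 := by positivity
    nlinarith
  linarith

theorem lintegral_ball_le (n : ℕ) (R : ℝ) : ∃ N : ℕ, ∀ H : En n → ℝ, Continuous H →
    ZPeriodic H →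
    ∫⁻ x in Metric.closedBall (0 : En n) R, ENNReal.ofReal (H x)
      ≤ N * ∫⁻ x in unitCube n, ENNReal.ofReal (H x) := by
  classical
  set m : ℤ := ⌈R⌉ + 1
  set K : Finset (Fin n → ℤ) := Fintype.piFinset (fun _ => Finset.Icc (-m) m)
  let τ : (Fin n → ℤ) → En n := fun k => (WithLp.equiv 2 (Fin n → ℝ)).symm (fun i => (k i : ℝ))
  refine ⟨K.card, fun H hH pH => ?_⟩
  have hsub : Metric.closedBall (0 : En n) R
      ⊆ ⋃ k ∈ K, (fun x => x - τ k) ⁻¹' unitCube n := by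
    intro x hx
    have hx' : ‖x‖ ≤ R := by simpa using hx
    simp only [Set.mem_iUnion]
    refine ⟨fun i => ⌊x i⌋, ?_, ?_⟩
    · simp only [K, Fintype.mem_piFinset, Finset.mem_Icc]
      intro i
      have h1 : |x i| ≤ R := (PiLp.norm_apply_le x i).trans hx'
      have h2 := abs_le.1 h1
      have h3 : R ≤ ⌈R⌉ := Int.le_ceil R
      constructor
      · rw [Int.le_floor]; simp only [m]; push_cast; linarith
      · have : (⌊x i⌋ : ℝ) ≤ x i := Int.floor_le _
        have : (⌊x i⌋ : ℝ) ≤ ((⌈R⌉ + 1 : ℤ) : ℝ) := by push_cast; linarith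
        exact_mod_cast this
    · intro i
      have e : (x - τ (fun i => ⌊x i⌋)) i = x i - ⌊x i⌋ := by simp [τ]
      simp only [e]
      exact ⟨by linarith [Int.floor_le (x i)], by linarith [Int.lt_floor_add_one (x i)]⟩
  have hmono := lintegral_mono_set (μ := volume) (f := fun x => ENNReal.ofReal (H x)) hsub
  refine hmono.trans ?_
  have hbi : ∀ L : Finset (Fin n → ℤ),
      ∫⁻ x in ⋃ k ∈ L, (fun x => x - τ k) ⁻¹' unitCube n, ENNReal.ofReal (H x)
        ≤ ∑ k ∈ L, ∫⁻ x in (fun x => x - τ k) ⁻¹' unitCube n, ENNReal.ofReal (H x) := by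
    intro L
    induction L using Finset.induction_on with
    | empty => simp
    | insert k L hk ih =>
      rw [Finset.set_biUnion_insert, Finset.sum_insert hk]
      exact (lintegral_union_le _ _ _).trans (by gcongr)
  refine (hbi K).trans ?_
  have : ∀ k ∈ K, ∫⁻ x in (fun x => x - τ k) ⁻¹' unitCube n, ENNReal.ofReal (H x)
      = ∫⁻ x in unitCube n, ENNReal.ofReal (H x) := by
    intro k _
    have hmp : MeasurePreserving (fun x : En n => x - τ k) volume volume :=
      measurePreserving_sub_right volume (τ k)
    have hm : Measurable (fun x => ENNReal.ofReal (H x)) := hH.measurable.ennreal_ofReal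
    rw [← hmp.setLIntegral_comp_preimage (measurableSet_unitCube n) hm]
    congr 1
    funext x
    have := pH (x - τ k) k
    have e : x - τ k + (WithLp.equiv 2 (Fin n → ℝ)).symm (fun i => (k i : ℝ)) = x :=
      sub_add_cancel x (τ k)
    rw [e] at this
    rw [this]
  rw [Finset.sum_congr rfl this]
  simp

theorem exists_cutoff (n : ℕ) : ∃ χ : En n → ℝ, ContDiff ℝ 2 χ ∧ HasCompactSupport χ ∧
    (∀ x ∈ unitCube n, χ x = 1) ∧ ∃ C R : ℝ, 0 ≤ C ∧
      (∀ x, x ∉ Metric.closedBall (0 : En n) R → x ∉ tsupport χ) ∧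
      ∀ g : En n → ℝ, ContDiff ℝ 2 g → ∀ x,
        ‖fderiv ℝ (fderiv ℝ (fun y => χ y * g y)) x‖
          ≤ C * (|g x| + ‖fderiv ℝ g x‖ + ‖fderiv ℝ (fderiv ℝ g) x‖) := by
  let χ : ContDiffBump (0 : En n) := ⟨n + 1, n + 2, by positivity, by linarith⟩
  have hχ : ContDiff ℝ 2 χ := χ.contDiff
  have hc : HasCompactSupport χ := χ.hasCompactSupport
  have hb : ∀ k : ℕ, k ≤ 2 → ∃ C, ∀ x, ‖iteratedFDeriv ℝ k χ x‖ ≤ C := by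
    intro k hk
    refine (hc.iteratedFDeriv k).exists_bound_of_continuous ?_
    exact hχ.continuous_iteratedFDeriv (by exact_mod_cast hk)
  obtain ⟨C0, h0⟩ := hb 0 (by norm_num)
  obtain ⟨C1, h1⟩ := hb 1 (by norm_num)
  obtain ⟨C2, h2⟩ := hb 2 (by norm_num)
  have p0 := (norm_nonneg _).trans (h0 0)
  have p1 := (norm_nonneg _).trans (h1 0)
  have p2 := (norm_nonneg _).trans (h2 0)
  refine ⟨χ, hχ, hc, ?_, C0 + 2 * C1 + C2, n + 2, by positivity, ?_, ?_⟩
  · intro x hx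
    apply χ.one_of_mem_closedBall
    rw [mem_closedBall_zero_iff]
    show ‖x‖ ≤ (n : ℝ) + 1
    have e : x = ∑ i, x i • (EuclideanSpace.single i (1 : ℝ) : En n) := by
      ext j
      simp [Finset.sum_apply, Pi.single_apply]
    have : ‖x‖ ≤ ∑ i : Fin n, (1 : ℝ) := by
      rw [e]
      refine (norm_sum_le _ _).trans (Finset.sum_le_sum fun i _ => ?_)
      rw [norm_smul]
      have := hx i
      simp only [PiLp.norm_single, norm_one, mul_one, Real.norm_eq_abs]
      exact abs_le.2 ⟨by linarith [this.1], this.2⟩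
    simp at this
    linarith
  · intro x hx
    rw [χ.tsupport_eq]
    exact hx
  · intro g hg x
    have := norm_iteratedFDeriv_mul_le (𝕜 := ℝ) hχ hg x (n := 2) (by norm_num)
    simp only [Finset.sum_range_succ, Finset.sum_range_zero] at this
    have e : ∀ (f : En n → ℝ), ‖iteratedFDeriv ℝ 2 f x‖ = ‖fderiv ℝ (fderiv ℝ f) x‖ := by
      intro f
      rw [← norm_iteratedFDeriv_one, norm_iteratedFDeriv_fderiv]
    have k0 := h0 x
    have k1 := h1 x
    have k2 := h2 x
    have q0 := norm_nonneg (iteratedFDeriv ℝ 0 χ x)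
    have q1 := norm_nonneg (iteratedFDeriv ℝ 1 χ x)
    have q2 := norm_nonneg (iteratedFDeriv ℝ 2 χ x)
    simp only [e, norm_iteratedFDeriv_one, norm_iteratedFDeriv_zero] at this k0 k1 k2 q0 q1 q2
    norm_num [norm_iteratedFDeriv_one, norm_iteratedFDeriv_zero, e] at this
    have e1 : ‖iteratedFDeriv ℝ (2 - 1) g x‖ = ‖fderiv ℝ g x‖ := norm_iteratedFDeriv_one g
    have e0 : ‖iteratedFDeriv ℝ (2 - 2) g x‖ = |g x| := norm_iteratedFDeriv_zero
    rw [e1, e0] at this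
    have r1 := norm_nonneg (fderiv ℝ g x)
    have r2 := norm_nonneg (fderiv ℝ (fderiv ℝ g) x)
    have r0 := abs_nonneg (g x)
    rw [Real.norm_eq_abs] at k0
    have m1 := mul_le_mul_of_nonneg_right k0 r2
    have m2 := mul_le_mul_of_nonneg_right k1 r1
    have m3 := mul_le_mul_of_nonneg_right k2 r0
    have s1 := mul_nonneg p0 r0
    have s2 := mul_nonneg p0 r1
    have s3 := mul_nonneg p1 r0
    have s4 := mul_nonneg p1 r2
    have s5 := mul_nonneg p2 r1
    have s6 := mul_nonneg p2 r2
    have s7 := mul_nonneg p1 r1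
    nlinarith

theorem sobolev_compact (n : ℕ) (hn : 5 ≤ n) : ∃ K : NNReal, ∀ w : En n → ℝ, ContDiff ℝ 2 w →
    HasCompactSupport w →
    eLpNorm w (((2 * n / (n - 4) : ℝ).toNNReal : NNReal) : ENNReal) volume
      ≤ K * eLpNorm (fderiv ℝ (fderiv ℝ w)) 2 volume := by
  have h5 : (5 : ℝ) ≤ n := by exact_mod_cast hn
  set p : NNReal := (2 * n / (n - 4) : ℝ).toNNReal
  set p1 : NNReal := (2 * n / (n - 2) : ℝ).toNNReal
  have hp : (p : ℝ) = 2 * n / (n - 4) := Real.coe_toNNReal _ (by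
    apply div_nonneg <;> linarith)
  have hp1 : (p1 : ℝ) = 2 * n / (n - 2) := Real.coe_toNNReal _ (by
    apply div_nonneg <;> linarith)
  have n0 : (n : ℝ) ≠ 0 := by linarith
  refine ⟨SNormLESNormFDerivOfEqConst ℝ (volume : Measure (En n)) p1
    * SNormLESNormFDerivOfEqConst (En n →L[ℝ] ℝ) (volume : Measure (En n)) ((2 : NNReal) : ℝ),
    fun w hw cw => ?_⟩
  · have A := eLpNorm_le_eLpNorm_fderiv_of_eq (μ := (volume : Measure (En n)))
      (hw.of_le (by norm_num)) cw (p := p1) (p' := p) ?_ ?_ ?_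
    · have B := eLpNorm_le_eLpNorm_fderiv_of_eq (μ := (volume : Measure (En n)))
        (hw.fderiv_right (m := 1) (by norm_num)) (cw.fderiv (𝕜 := ℝ)) (p := 2) (p' := p1)
        ?_ ?_ ?_
      · refine A.trans ?_
        refine (mul_le_mul_right B _).trans ?_
        rw [← mul_assoc, ← ENNReal.coe_mul]
        exact le_rfl
      · norm_num
      · simp; omega
      · rw [hp1]
        simp
        have : (n : ℝ) - 2 ≠ 0 := by linarith
        field_simp
    · rw [← NNReal.coe_le_coe, hp1, NNReal.coe_one, le_div_iff₀ (by linarith)]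
      linarith
    · simp; omega
    · rw [hp]
      rw [NNReal.coe_inv, hp1]
      simp
      have : (n : ℝ) - 2 ≠ 0 := by linarith
      have : (n : ℝ) - 4 ≠ 0 := by linarith
      field_simp
      ring

set_option maxHeartbeats 1000000 in
/-- Sobolev inequality on the torus. -/
theorem sobolev_torus (n : ℕ) (hn : 5 ≤ n) : ∃ S : ℝ, 0 < S ∧ ∀ g : En n → ℝ,
    ContDiff ℝ 2 g → ZPeriodic g →
    (∫ x in unitCube n, |g x| ^ (2 * n / (n - 4) : ℝ)) ^ (((n : ℝ) - 4) / n)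
      ≤ S * ∫ x in unitCube n, hDens g x := by
  have h5 : (5 : ℝ) ≤ n := by exact_mod_cast hn
  obtain ⟨χ, hχ, cχ, χ1, C, R, hC, hR, hbd⟩ := exists_cutoff n
  obtain ⟨K, hK⟩ := sobolev_compact n hn
  obtain ⟨N, hN⟩ := lintegral_ball_le n R
  set P : ℝ := 2 * n / (n - 4) with hP
  have P0 : 0 < P := by apply div_pos <;> linarith
  set D : ℝ := C ^ 2 * (3 * (1 + n + (n : ℝ) ^ 2)) with hD
  have D0 : 0 ≤ D := by positivity
  refine ⟨(K : ℝ) ^ 2 * D * N + 1, by positivity, fun g hg pg => ?_⟩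
  have hH := hDens_cont hg
  have I0 : 0 ≤ ∫ x in unitCube n, hDens g x := I_nonneg fun x => hDens_nonneg g x
  have key : ENNReal.ofReal ((∫ x in unitCube n, |g x| ^ P) ^ (((n : ℝ) - 4) / n))
      ≤ ENNReal.ofReal ((K : ℝ) ^ 2 * D * N * ∫ x in unitCube n, hDens g x) := by
    set w : En n → ℝ := fun y => χ y * g y with hw
    have cw : HasCompactSupport w := cχ.mul_right
    have sw : ContDiff ℝ 2 w := hχ.mul hg
    have e1 : ENNReal.ofReal (∫ x in unitCube n, |g x| ^ P) ≤ eLpNorm w (P.toNNReal) volume ^ P := by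
      rw [ofReal_integral_eq_lintegral_ofReal]
      · have e := eLpNorm_nnreal_pow_eq_lintegral (f := w) (μ := volume) (p := P.toNNReal)
          (by simpa using P0)
        rw [Real.coe_toNNReal _ P0.le] at e
        rw [e]
        calc ∫⁻ x in unitCube n, ENNReal.ofReal (|g x| ^ P)
            = ∫⁻ x in unitCube n, ‖w x‖ₑ ^ P := by
              refine setLIntegral_congr_fun (measurableSet_unitCube n) fun x hx => ?_
              simp only [hw, χ1 x hx, one_mul]
              rw [← ENNReal.ofReal_rpow_of_nonneg (abs_nonneg _) P0.le, ← Real.norm_eq_abs,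
                ofReal_norm]
          _ ≤ _ := setLIntegral_le_lintegral _ _
      · exact int_cont (hg.continuous.abs.rpow_const fun _ => Or.inr P0.le)
      · exact ae_of_all _ fun x => Real.rpow_nonneg (abs_nonneg _) _
    have e2 : eLpNorm (fderiv ℝ (fderiv ℝ w)) 2 volume ^ (2 : ℝ)
        ≤ ENNReal.ofReal (D * N * ∫ x in unitCube n, hDens g x) := by
      have e := eLpNorm_nnreal_pow_eq_lintegral (f := fderiv ℝ (fderiv ℝ w)) (μ := volume) (p := 2)
          (by norm_num)
      have e' : eLpNorm (fderiv ℝ (fderiv ℝ w)) 2 volume ^ (2 : ℝ)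
        = ∫⁻ x, ‖fderiv ℝ (fderiv ℝ w) x‖ₑ ^ (2 : ℝ) := by simpa using e
      rw [e']
      calc ∫⁻ x, ‖fderiv ℝ (fderiv ℝ w) x‖ₑ ^ (2 : ℝ)
          ≤ ∫⁻ x, (Metric.closedBall (0 : En n) R).indicator
              (fun x => ENNReal.ofReal (D * hDens g x)) x := by
            refine lintegral_mono fun x => ?_
            by_cases hx : x ∈ Metric.closedBall (0 : En n) R
            · rw [Set.indicator_of_mem hx]
              rw [← ofReal_norm, ENNReal.ofReal_rpow_of_nonneg (norm_nonneg _) (by norm_num)]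
              apply ENNReal.ofReal_le_ofReal
              have b1 := hbd g hg x
              have b2 := hDens_bound hg x
              have b3 := pow_le_pow_left₀ (norm_nonneg (fderiv ℝ (fderiv ℝ w) x)) b1 2
              rw [Real.rpow_two]
              rw [mul_pow] at b3
              have b4 := mul_le_mul_of_nonneg_left b2 (sq_nonneg C)
              rw [hD]
              linarith
            · rw [Set.indicator_of_notMem hx]
              have t : x ∉ tsupport w := fun h => hR x hx (tsupport_mul_subset_left h)
              have t2 : x ∉ tsupport (fderiv ℝ (fderiv ℝ w)) := fun h =>
                t (tsupport_fderiv_subset ℝ (tsupport_fderiv_subset ℝ h))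
              have hz : fderiv ℝ (fderiv ℝ w) x = 0 := image_eq_zero_of_notMem_tsupport t2
              have hz' : ‖fderiv ℝ (fderiv ℝ w) x‖ = 0 := by
                refine le_antisymm ?_ (norm_nonneg (fderiv ℝ (fderiv ℝ w) x))
                refine ContinuousLinearMap.opNorm_le_bound _ le_rfl fun v => ?_
                rw [hz, ContinuousLinearMap.zero_apply, norm_zero, zero_mul]
              rw [← ofReal_norm, hz', ENNReal.ofReal_zero, ENNReal.zero_rpow_of_pos (by norm_num)]
        _ = ∫⁻ x in Metric.closedBall (0 : En n) R, ENNReal.ofReal (D * hDens g x) :=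
            lintegral_indicator Metric.isClosed_closedBall.measurableSet _
        _ ≤ N * ∫⁻ x in unitCube n, ENNReal.ofReal (D * hDens g x) :=
            hN _ (hH.const_mul D) (fun x k => by simp only [hDens_per pg x k])
        _ = _ := by
            rw [← ofReal_integral_eq_lintegral_ofReal (int_cont (hH.const_mul D))
              (ae_of_all _ fun x => mul_nonneg D0 (hDens_nonneg g x)), I_smul]
            rw [← ENNReal.ofReal_natCast, ← ENNReal.ofReal_mul (by positivity)]
            congr 1; ring
    have q0 : 0 ≤ ((n : ℝ) - 4) / n := div_nonneg (by linarith) (by linarith)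
    have hPq : P * (((n : ℝ) - 4) / n) = 2 := by
      rw [hP]
      have : (n : ℝ) - 4 ≠ 0 := by linarith
      have : (n : ℝ) ≠ 0 := by linarith
      field_simp
    rw [← ENNReal.ofReal_rpow_of_nonneg
      (I_nonneg fun x => Real.rpow_nonneg (abs_nonneg _) _) q0]
    calc _ ≤ (eLpNorm w (P.toNNReal) volume ^ P) ^ (((n : ℝ) - 4) / n) :=
          ENNReal.rpow_le_rpow e1 q0
      _ = eLpNorm w (P.toNNReal) volume ^ (2 : ℝ) := by rw [← ENNReal.rpow_mul, hPq]
      _ ≤ (K * eLpNorm (fderiv ℝ (fderiv ℝ w)) 2 volume) ^ (2 : ℝ) :=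
          ENNReal.rpow_le_rpow (hK w sw cw) (by norm_num)
      _ = (K : ENNReal) ^ (2 : ℝ) * eLpNorm (fderiv ℝ (fderiv ℝ w)) 2 volume ^ (2 : ℝ) :=
          ENNReal.mul_rpow_of_nonneg _ _ (by norm_num)
      _ ≤ (K : ENNReal) ^ (2 : ℝ) * ENNReal.ofReal (D * N * ∫ x in unitCube n, hDens g x) :=
          mul_le_mul_right e2 _
      _ = _ := by
          rw [← ENNReal.ofReal_coe_nnreal (p := K), ENNReal.ofReal_rpow_of_nonneg (NNReal.coe_nonneg K) (by norm_num),
            ← ENNReal.ofReal_mul (by positivity), Real.rpow_two]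
          congr 1; ring
  have k0 : 0 ≤ (K : ℝ) ^ 2 * D * N * ∫ x in unitCube n, hDens g x := by positivity
  have := (ENNReal.ofReal_le_ofReal_iff k0).1 key
  linarith

/-! ### One-dimensional cutoffs -/

theorem periodic_bdd {f : ℝ → ℝ} (hf : Continuous f) (pf : Function.Periodic f 1) :
    ∃ B : ℝ, 0 ≤ B ∧ ∀ t, |f t| ≤ B := by
  obtain ⟨B, hB⟩ := isCompact_Icc.exists_bound_of_continuousOn (s := Set.Icc (0 : ℝ) 1)
    hf.continuousOn
  refine ⟨B, (norm_nonneg _).trans (hB 0 (by simp)), fun t => ?_⟩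
  obtain ⟨y, hy, e⟩ := pf.exists_mem_Ico₀ (by norm_num) t
  rw [e]
  exact hB y ⟨hy.1, hy.2.le⟩

theorem deriv_periodic {f : ℝ → ℝ} (pf : Function.Periodic f 1) :
    Function.Periodic (deriv f) 1 := by
  intro t
  have : (fun s => f (s + 1)) = f := funext pf
  rw [← deriv_comp_add_const, this]

theorem exists_level (m : ℕ) : ∃ c : ℝ, 0 < c ∧ c < 1 ∧ ∀ j k : Fin m, j ≠ k →
    cos (2 * π * ((j : ℝ) / m - (k : ℝ) / m)) < 2 * c ^ 2 - 1 := by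
  have h1 : ∀ᶠ c : ℝ in nhdsWithin 1 (Set.Iio 1), 0 < c :=
    nhdsWithin_le_nhds (lt_mem_nhds (by norm_num))
  have h2 : ∀ᶠ c : ℝ in nhdsWithin 1 (Set.Iio 1), c < 1 := self_mem_nhdsWithin
  have h3 : ∀ᶠ c : ℝ in nhdsWithin 1 (Set.Iio 1), ∀ j k : Fin m, j ≠ k →
      cos (2 * π * ((j : ℝ) / m - (k : ℝ) / m)) < 2 * c ^ 2 - 1 := by
    rw [eventually_all]; intro j
    rw [eventually_all]; intro k
    rw [eventually_imp_distrib_left]; intro hjk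
    have hlt : cos (2 * π * ((j : ℝ) / m - (k : ℝ) / m)) < 1 := by
      refine lt_of_le_of_ne (cos_le_one _) fun he => ?_
      rw [Real.cos_eq_one_iff] at he
      obtain ⟨z, hz⟩ := he
      have hm : (0 : ℝ) < m := by exact_mod_cast j.pos
      have : (z : ℝ) * m = (j : ℝ) - k := by
        have hpi := Real.pi_pos.ne'
        have : (z : ℝ) = (j : ℝ) / m - (k : ℝ) / m := by
          have : 2 * π * (z : ℝ) = 2 * π * ((j : ℝ) / m - (k : ℝ) / m) := by rw [← hz]; ring
          exact mul_left_cancel₀ (by positivity) this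
        rw [this]; field_simp
      have hz2 : z * (m : ℤ) = (j : ℤ) - (k : ℤ) := by exact_mod_cast this
      have hj := j.2
      have hk := k.2
      have : z = 0 := by
        by_contra hne
        rcases lt_or_gt_of_ne hne with h | h
        · have : z * (m : ℤ) ≤ -1 * (m : ℤ) := by
            apply mul_le_mul_of_nonneg_right <;> omega
          omega
        · have : 1 * (m : ℤ) ≤ z * (m : ℤ) := by
            apply mul_le_mul_of_nonneg_right <;> omega
          omega
      subst this
      apply hjk; ext; omega
    have hc : ContinuousAt (fun c : ℝ => 2 * c ^ 2 - 1) 1 := by fun_prop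
    refine nhdsWithin_le_nhds (hc.eventually (lt_mem_nhds ?_))
    norm_num; exact hlt
  obtain ⟨c, ⟨a, b⟩, d⟩ := ((h1.and h2).and h3).exists
  exact ⟨c, a, b, d⟩

theorem exists_bump (c : ℝ) (hc : c < 1) : ∃ (Θ Φ : ℝ → ℝ) (M κ : ℝ), 0 < M ∧ 0 < κ ∧
    ContDiff ℝ 3 Θ ∧ Function.Periodic Θ 1 ∧ (∀ t, |deriv Θ t| ≤ M) ∧
    (∀ t, |deriv (deriv Θ) t| ≤ M) ∧
    (∀ t, |deriv (deriv (fun s => Θ s ^ 2)) t| ≤ M * |Θ t|) ∧ (∀ t, |Θ t| ≤ M) ∧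
    (∀ t, Θ t ≠ 0 → c < cos (2 * π * t)) ∧
    ContDiff ℝ 3 Φ ∧ Function.Periodic Φ 1 ∧ deriv Φ = fun t => 1 - κ * Θ t ^ 2 := by
  set η : ℝ → ℝ := fun t => expNegInvGlue (cos (2 * π * t) - c) with hη
  have sη : ContDiff ℝ 4 η := by
    refine (expNegInvGlue.contDiff (n := 4)).comp ?_
    have : ContDiff ℝ 4 (fun t : ℝ => 2 * π * t) := by fun_prop
    exact (Real.contDiff_cos.comp this).sub contDiff_const
  have pη : Function.Periodic η 1 := by
    intro t
    simp only [hη]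
    rw [mul_add, mul_one, Real.cos_add_two_pi]
  set Θ : ℝ → ℝ := fun t => η t ^ 2 with hΘ
  have sΘ : ContDiff ℝ 4 Θ := sη.pow 2
  have pΘ : Function.Periodic Θ 1 := fun t => by simp only [hΘ, pη t]
  have dη : Differentiable ℝ η := sη.differentiable (by norm_num)
  have sη1 : ContDiff ℝ 3 (deriv η) := by
    have := (contDiff_succ_iff_deriv (n := 3) (f := η) (𝕜 := ℝ)).1 (by
      rw [show (3 : WithTop ℕ∞) + 1 = 4 by norm_num]; exact sη)
    exact this.2.2
  have dη1 : Differentiable ℝ (deriv η) := sη1.differentiable (by norm_num)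
  have sη2 : ContDiff ℝ 2 (deriv (deriv η)) := by
    have := (contDiff_succ_iff_deriv (n := 2) (f := deriv η) (𝕜 := ℝ)).1 (by
      rw [show (2 : WithTop ℕ∞) + 1 = 3 by norm_num]; exact sη1)
    exact this.2.2
  have sΘ1 : ContDiff ℝ 3 (deriv Θ) := by
    have := (contDiff_succ_iff_deriv (n := 3) (f := Θ) (𝕜 := ℝ)).1 (by
      rw [show (3 : WithTop ℕ∞) + 1 = 4 by norm_num]; exact sΘ)
    exact this.2.2
  have sΘ2 : ContDiff ℝ 2 (deriv (deriv Θ)) := by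
    have := (contDiff_succ_iff_deriv (n := 2) (f := deriv Θ) (𝕜 := ℝ)).1 (by
      rw [show (2 : WithTop ℕ∞) + 1 = 3 by norm_num]; exact sΘ1)
    exact this.2.2
  obtain ⟨B0, z0, hB0⟩ := periodic_bdd sΘ.continuous pΘ
  obtain ⟨B1, z1, hB1⟩ := periodic_bdd sΘ1.continuous (deriv_periodic pΘ)
  obtain ⟨B2, z2, hB2⟩ := periodic_bdd sΘ2.continuous (deriv_periodic (deriv_periodic pΘ))
  obtain ⟨B3, z3, hB3⟩ := periodic_bdd
    (f := fun t => 12 * deriv η t ^ 2 + 4 * η t * deriv (deriv η) t)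
    (by have := sη.continuous; have := sη1.continuous; have := sη2.continuous; fun_prop)
    (fun t => by simp only [pη t, deriv_periodic pη t, deriv_periodic (deriv_periodic pη) t])
  have e1 : deriv (fun s => Θ s ^ 2) = fun s => 4 * η s ^ 3 * deriv η s := by
    funext s
    have h1 : (fun s => Θ s ^ 2) = fun s => η s ^ 4 := by
      funext s; simp only [hΘ]; ring
    rw [h1]
    have := ((dη s).hasDerivAt.pow 4).deriv
    refine Eq.trans this ?_
    push_cast
    norm_num
  have e2 : ∀ t, deriv (deriv (fun s => Θ s ^ 2)) t
      = Θ t * (12 * deriv η t ^ 2 + 4 * η t * deriv (deriv η) t) := by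
    intro t
    rw [e1]
    have := ((((dη t).hasDerivAt.pow 3).const_mul 4).mul (dη1 t).hasDerivAt).deriv
    refine Eq.trans this ?_
    simp only [hΘ, Pi.pow_apply]
    push_cast
    ring
  set I : ℝ := ∫ t in (0 : ℝ)..1, Θ t ^ 2 with hI
  have cΘ : Continuous (fun t => Θ t ^ 2) := sΘ.continuous.pow 2
  have hI0 : 0 < I := by
    refine intervalIntegral.integral_pos one_pos cΘ.continuousOn (fun x _ => sq_nonneg _)
      ⟨0, by simp, ?_⟩
    have : 0 < η 0 := by
      simp only [hη]
      apply expNegInvGlue.pos_of_pos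
      simp; exact hc
    simp only [hΘ]; positivity
  have hder : ∀ t, HasDerivAt (fun t => t - I⁻¹ * ∫ s in (0 : ℝ)..t, Θ s ^ 2)
      (1 - I⁻¹ * Θ t ^ 2) t := fun t =>
    (hasDerivAt_id t).sub ((cΘ.integral_hasStrictDerivAt 0 t).hasDerivAt.const_mul _)
  have hdd : deriv (fun t => t - I⁻¹ * ∫ s in (0 : ℝ)..t, Θ s ^ 2)
      = fun t => 1 - I⁻¹ * Θ t ^ 2 := funext fun t => (hder t).deriv
  refine ⟨Θ, fun t => t - I⁻¹ * ∫ s in (0 : ℝ)..t, Θ s ^ 2, B0 + B1 + B2 + B3 + 1, I⁻¹,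
    by positivity, inv_pos.2 hI0, sΘ.of_le (by norm_num), pΘ, fun t => ?_, fun t => ?_,
    fun t => ?_, fun t => ?_, fun t ht => ?_, ?_, fun t => ?_, hdd⟩
  · linarith [hB1 t]
  · linarith [hB2 t]
  · rw [e2, abs_mul, mul_comm]
    exact mul_le_mul_of_nonneg_right (by linarith [hB3 t]) (abs_nonneg _)
  · linarith [hB0 t]
  · by_contra hle
    apply ht
    simp only [hΘ, hη]
    rw [expNegInvGlue.zero_of_nonpos (by linarith)]
    norm_num
  · rw [show (3 : WithTop ℕ∞) = 2 + 1 by norm_num, contDiff_succ_iff_deriv]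
    refine ⟨fun t => (hder t).differentiableAt, by simp, ?_⟩
    rw [hdd]
    exact contDiff_const.sub (contDiff_const.mul ((sΘ.of_le (by norm_num)).pow 2))
  · have p2 : Function.Periodic (fun t => Θ t ^ 2) 1 := fun t => by simp only [pΘ t]
    have h1 := p2.intervalIntegral_add_eq t 0
    have h2 := intervalIntegral.integral_add_adjacent_intervals
      (cΘ.intervalIntegrable (μ := volume) 0 t) (cΘ.intervalIntegrable (μ := volume) t (t + 1))
    rw [zero_add] at h1
    simp only
    rw [← h2, h1, ← hI, mul_add, inv_mul_cancel₀ hI0.ne']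
    ring

/-- Families of cutoffs with disjoint supports. -/
theorem exists_cutoffs (m : ℕ) : ∃ (θ φ : Fin m → ℝ → ℝ) (M κ : ℝ), 0 < M ∧ 0 < κ ∧
    (∀ j, ContDiff ℝ 3 (θ j)) ∧ (∀ j, Function.Periodic (θ j) 1) ∧
    (∀ j t, |deriv (θ j) t| ≤ M) ∧ (∀ j t, |deriv (deriv (θ j)) t| ≤ M) ∧
    (∀ j t, |deriv (deriv (fun s => θ j s ^ 2)) t| ≤ M * |θ j t|) ∧
    (∀ j k, j ≠ k → ∀ t, θ j t = 0 ∨ θ k t = 0) ∧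
    (∀ j, ContDiff ℝ 3 (φ j)) ∧ (∀ j, Function.Periodic (φ j) 1) ∧
    (∀ j, deriv (φ j) = fun t => 1 - κ * θ j t ^ 2) := by
  obtain ⟨c, c0, c1, hcos⟩ := exists_level m
  obtain ⟨Θ, Φ, M, κ, M0, κ0, s, p, b1, b2, b3, -, hs, sΦ, pΦ, dΦ⟩ := exists_bump c c1
  have dd : ∀ (f : ℝ → ℝ) (r : ℝ), deriv (fun t => f (t - r)) = fun t => deriv f (t - r) :=
    fun f r => funext fun t => deriv_comp_sub_const ..
  have sub : ∀ {f : ℝ → ℝ} (r : ℝ), ContDiff ℝ 3 f → ContDiff ℝ 3 (fun t => f (t - r)) :=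
    fun r hf => hf.comp (contDiff_id.sub contDiff_const)
  have per : ∀ {f : ℝ → ℝ} (r : ℝ), Function.Periodic f 1 →
      Function.Periodic (fun t => f (t - r)) 1 := fun r hf t => by
    have := hf (t - r)
    simp only
    rw [← this]; congr 1; ring
  refine ⟨fun j t => Θ (t - (j : ℝ) / m), fun j t => Φ (t - (j : ℝ) / m), M, κ, M0, κ0,
    fun j => sub _ s, fun j => per _ p, fun j t => ?_, fun j t => ?_, fun j t => ?_,
    fun j k hjk t => ?_, fun j => sub _ sΦ, fun j => per _ pΦ, fun j => ?_⟩
  · rw [dd]; exact b1 _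
  · rw [dd, dd]; exact b2 _
  · rw [dd (fun s => Θ s ^ 2), dd]; exact b3 _
  · by_contra hne
    push Not at hne
    have h1 := hs _ hne.1
    have h2 := hs _ hne.2
    set A := 2 * π * (t - (j : ℝ) / m) with hA
    set B := 2 * π * (t - (k : ℝ) / m) with hB
    have e : cos (2 * π * ((j : ℝ) / m - (k : ℝ) / m)) = cos (B - A) := by
      congr 1; rw [hA, hB]; ring
    have h3 := hcos j k hjk
    rw [e, cos_sub] at h3
    have a1 := sin_sq_add_cos_sq A
    have a2 := sin_sq_add_cos_sq B
    nlinarith [sq_nonneg (sin A + sin B), mul_pos c0 c0, mul_pos (sub_pos.2 h1) (sub_pos.2 h2)]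
  · rw [dd, dΦ]

/-! ### Smallness on thin slabs -/

theorem integral_hDens_le {n : ℕ} {g : En n → ℝ} (hg : ContDiff ℝ 3 g) (pg : ZPeriodic g) {a : ℝ}
    (ha : 1 ≤ a) :
    ∫ x in unitCube n, hDens g x ≤ ∫ x in unitCube n, (lap g x + a * g x) ^ 2 := by
  rw [integral_P_sq hg pg a]
  have h1 : ∀ i, ContDiff ℝ 2 (pderiv' i g) := fun i => pd_contDiff (m := 2) i hg
  have h2 : ∀ i j, Continuous (fun x => (pderiv' i (pderiv' j g) x) ^ 2) := fun i j =>
    (pd_contDiff (m := 1) i (h1 j)).continuous.pow 2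
  have h3 : ∀ i, Continuous (fun x => (pderiv' i g x) ^ 2) := fun i => (h1 i).continuous.pow 2
  have h4 : ∀ i, Continuous (fun x => ∑ j, (pderiv' i (pderiv' j g) x) ^ 2) := fun i =>
    continuous_finsetSum _ fun j _ => h2 i j
  have e : ∫ x in unitCube n, hDens g x
      = ∑ i, ∑ j, (∫ x in unitCube n, (pderiv' i (pderiv' j g) x) ^ 2)
        + ∑ i, (∫ x in unitCube n, (pderiv' i g x) ^ 2) + ∫ x in unitCube n, (g x) ^ 2 := by
    unfold hDens
    have k1 : Continuous (fun x => ∑ i, ∑ j, (pderiv' i (pderiv' j g) x) ^ 2) :=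
      continuous_finsetSum _ fun i _ => h4 i
    have k2 : Continuous (fun x => ∑ i, (pderiv' i g x) ^ 2) :=
      continuous_finsetSum _ fun i _ => h3 i
    have k3 : Continuous (fun x => g x ^ 2) := hg.continuous.pow 2
    have k4 : Continuous (fun x => (∑ i, ∑ j, (pderiv' i (pderiv' j g) x) ^ 2)
      + ∑ i, (pderiv' i g x) ^ 2) := k1.add k2
    rw [I_add k4 k3, I_add k1 k2, I_sum _ h4, I_sum _ h3]
    congr 2
    exact Finset.sum_congr rfl fun i _ => I_sum _ (h2 i)
  rw [e]
  have z1 : 0 ≤ ∑ i, (∫ x in unitCube n, (pderiv' i g x) ^ 2) :=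
    Finset.sum_nonneg fun i _ => I_nonneg fun x => sq_nonneg _
  have z2 : 0 ≤ ∫ x in unitCube n, (g x) ^ 2 := I_nonneg fun x => sq_nonneg _
  have y1 := mul_le_mul_of_nonneg_right (show 1 ≤ 2 * a by linarith) z1
  have y2 := mul_le_mul_of_nonneg_right (show 1 ≤ a ^ 2 by nlinarith) z2
  linarith

theorem slab_holder {n : ℕ} (hn : 5 ≤ n) {u : En n → ℝ} (hu : Continuous u) (pos : ∀ x, 0 < u x)
    (i : Fin n) {θ : ℝ → ℝ} (hθ : Continuous θ) :
    ∫ x in unitCube n, θ (x i) ^ 2 * u x ^ (2 * n / (n - 4) : ℝ)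
      ≤ (∫ x in unitCube n, {x : En n | θ (x i) ≠ 0}.indicator
            (fun x => u x ^ (2 * n / (n - 4) : ℝ)) x) ^ ((4 : ℝ) / n)
        * (∫ x in unitCube n, |θ (x i) * u x| ^ (2 * n / (n - 4) : ℝ)) ^ (((n : ℝ) - 4) / n) := by
  have h5 : (5 : ℝ) ≤ n := by exact_mod_cast hn
  have n0 : (n : ℝ) ≠ 0 := by linarith
  have n4 : (n : ℝ) - 4 ≠ 0 := by linarith
  have : IsFiniteMeasure (volume.restrict (unitCube n)) :=
    ⟨by simpa using (isCompact_unitCube n).measure_lt_top⟩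
  have hci : Continuous (fun x : En n => θ (x i)) :=
    hθ.comp (EuclideanSpace.proj i : En n →L[ℝ] ℝ).continuous
  have hmeas : MeasurableSet {x : En n | θ (x i) ≠ 0} :=
    (isOpen_ne_fun hci continuous_const).measurableSet
  have memc : ∀ {f : En n → ℝ} (p : ENNReal), Continuous f →
      MemLp f p (volume.restrict (unitCube n)) := by
    intro f p hf
    obtain ⟨B, hB⟩ := (isCompact_unitCube n).exists_bound_of_continuousOn hf.continuousOn
    refine MemLp.of_bound hf.aestronglyMeasurable B ?_
    exact (ae_restrict_iff' (measurableSet_unitCube n)).2 (ae_of_all _ hB)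
  have hup : ∀ r : ℝ, Continuous (fun x => u x ^ r) := fun r =>
    hu.rpow_const fun x => Or.inl (pos x).ne'
  have hpq : ((n : ℝ) / 4).HolderConjugate ((n : ℝ) / (n - 4)) := by
    rw [Real.holderConjugate_iff]
    constructor
    · rw [lt_div_iff₀ (by norm_num)]; linarith
    · field_simp; ring
  have H := integral_mul_le_Lp_mul_Lq_of_nonneg (μ := volume.restrict (unitCube n)) hpq
    (f := {x : En n | θ (x i) ≠ 0}.indicator (fun x => u x ^ (8 / (n - 4) : ℝ)))
    (g := fun x => (θ (x i) * u x) ^ 2)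
    (ae_of_all _ fun x => Set.indicator_nonneg (fun x _ => Real.rpow_nonneg (pos x).le _) x)
    (ae_of_all _ fun x => sq_nonneg _)
    ((memc _ (hup _)).indicator hmeas) (memc _ ((hci.mul hu).pow 2))
  have e0 : ∀ x, {x : En n | θ (x i) ≠ 0}.indicator (fun x => u x ^ (8 / (n - 4) : ℝ)) x
      * (θ (x i) * u x) ^ 2 = θ (x i) ^ 2 * u x ^ (2 * n / (n - 4) : ℝ) := by
    intro x
    by_cases hx : θ (x i) = 0
    · simp [hx]
    · rw [Set.indicator_of_mem (by exact hx)]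
      have : u x ^ (2 * n / (n - 4) : ℝ) = u x ^ (8 / (n - 4) : ℝ) * u x ^ 2 := by
        rw [← Real.rpow_natCast, ← Real.rpow_add (pos x)]
        congr 1; field_simp; push_cast; ring
      rw [this]; ring
  have e1 : ∀ x, ({x : En n | θ (x i) ≠ 0}.indicator (fun x => u x ^ (8 / (n - 4) : ℝ)) x)
      ^ ((n : ℝ) / 4) = {x : En n | θ (x i) ≠ 0}.indicator
        (fun x => u x ^ (2 * n / (n - 4) : ℝ)) x := by
    intro x
    by_cases hx : θ (x i) = 0
    · rw [Set.indicator_of_notMem (by simpa using hx), Set.indicator_of_notMem (by simpa using hx),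
        Real.zero_rpow (by positivity)]
    · rw [Set.indicator_of_mem (by exact hx), Set.indicator_of_mem (by exact hx),
        ← Real.rpow_mul (pos x).le]
      congr 1; field_simp; norm_num
  have e2 : ∀ x : En n, ((θ (x i) * u x) ^ 2) ^ ((n : ℝ) / (n - 4))
      = |θ (x i) * u x| ^ (2 * n / (n - 4) : ℝ) := by
    intro x
    rw [← sq_abs, ← Real.rpow_natCast, ← Real.rpow_mul (abs_nonneg _)]
    congr 1; push_cast; ring
  simp only [e0, e1, e2] at H
  rw [one_div_div, one_div_div] at H
  exact H

/-- Pigeonhole choice of a slab carrying little energy. -/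
theorem exists_slab {n m : ℕ} (hm : 0 < m) {f : En n → ℝ} (hf : Continuous f) (pos : ∀ x, 0 < f x)
    {Λ : ℝ} (hΛ : ∫ x in unitCube n, f x ≤ Λ) (i : Fin n) {θ : Fin m → ℝ → ℝ}
    (hθ : ∀ j, Continuous (θ j)) (hd : ∀ j k, j ≠ k → ∀ t, θ j t = 0 ∨ θ k t = 0) :
    ∃ j, ∫ x in unitCube n, {x : En n | θ j (x i) ≠ 0}.indicator f x ≤ Λ / m := by
  have hmeas : ∀ j, MeasurableSet {x : En n | θ j (x i) ≠ 0} := fun j =>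
    (isOpen_ne_fun ((hθ j).comp (EuclideanSpace.proj i : En n →L[ℝ] ℝ).continuous)
      continuous_const).measurableSet
  have hint : ∀ j, IntegrableOn ({x : En n | θ j (x i) ≠ 0}.indicator f) (unitCube n) := fun j =>
    (int_cont hf).indicator (hmeas j)
  have hsum : ∑ j, ∫ x in unitCube n, {x : En n | θ j (x i) ≠ 0}.indicator f x ≤ Λ := by
    rw [← integral_finsetSum _ fun j _ => hint j]
    refine le_trans (setIntegral_mono (integrable_finsetSum _ fun j _ => hint j) (int_cont hf)
      fun x => ?_) hΛ
    by_cases h : ∃ j, θ j (x i) ≠ 0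
    · obtain ⟨j, hj⟩ := h
      rw [Finset.sum_eq_single j]
      · rw [Set.indicator_of_mem (by exact hj)]
      · intro k _ hk
        rw [Set.indicator_of_notMem]
        have := (hd k j hk (x i)).resolve_right hj
        simpa using this
      · simp
    · push Not at h
      rw [Finset.sum_eq_zero]
      · exact (pos x).le
      · intro j _
        rw [Set.indicator_of_notMem]
        simpa using h j
  have hm' : (m : ℝ) ≠ 0 := by exact_mod_cast hm.ne'
  have : Nonempty (Fin m) := ⟨⟨0, hm⟩⟩
  obtain ⟨j, -, hj⟩ := Finset.exists_le_of_sum_le (s := Finset.univ)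
    (f := fun j => ∫ x in unitCube n, {x : En n | θ j (x i) ≠ 0}.indicator f x)
    (g := fun _ => Λ / m) Finset.univ_nonempty (by
      simp only [Finset.sum_const, Finset.card_univ, Fintype.card_fin, nsmul_eq_mul]
      rw [mul_div_cancel₀ _ hm']; exact hsum)
  exact ⟨j, hj⟩

theorem exists_m (n : ℕ) (hn : 5 ≤ n) (S Λ : ℝ) :
    ∃ m : ℕ, 0 < m ∧ 12 * ((Λ / m) ^ ((4 : ℝ) / n) * S) ≤ 1 := by
  have h5 : (5 : ℝ) ≤ n := by exact_mod_cast hn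
  have h1 : Tendsto (fun m : ℕ => Λ / (m : ℝ)) atTop (nhds 0) :=
    tendsto_const_div_atTop_nhds_zero_nat Λ
  have h2 : Tendsto (fun m : ℕ => 12 * ((Λ / (m : ℝ)) ^ ((4 : ℝ) / n) * S)) atTop (nhds 0) := by
    have := ((h1.rpow_const (p := (4 : ℝ) / n) (Or.inr (by positivity))).mul_const S).const_mul 12
    rwa [Real.zero_rpow (by positivity), zero_mul, mul_zero] at this
  obtain ⟨m, hm, hm0⟩ := ((h2.eventually (gt_mem_nhds (show (0 : ℝ) < 1 by norm_num))).and
    (eventually_gt_atTop 0)).exists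
  exact ⟨m, hm0, hm.le⟩

/-! ### Conclusion -/

theorem integral_sq_pos {n : ℕ} {u : En n → ℝ} (hu : Continuous u) (pos : ∀ x, 0 < u x) :
    0 < ∫ x in unitCube n, u x ^ 2 := by
  have hv : ∫ x in unitCube n, (1 : ℝ) = 1 := by
    rw [integral_unitCube]
    simp [Measure.real, Real.volume_Icc_pi]
  have h0 : (0 : En n) ∈ unitCube n := fun i => by simp
  obtain ⟨z, -, hz⟩ := (isCompact_unitCube n).exists_isMinOn ⟨0, h0⟩ hu.continuousOn
  have h1 : ∫ x in unitCube n, (u z ^ 2 * (1 : ℝ)) ≤ ∫ x in unitCube n, u x ^ 2 := by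
    refine setIntegral_mono_on (int_cont continuous_const) (int_cont (hu.pow 2))
      (measurableSet_unitCube n) fun x hx => ?_
    rw [mul_one]
    exact pow_le_pow_left₀ (pos z).le (hz hx) 2
  rw [I_smul, hv, mul_one] at h1
  exact lt_of_lt_of_le (pow_pos (pos z) 2) h1

theorem IsSol.term_bound {n : ℕ} {a q : ℝ} {u : En n → ℝ} (h : IsSol a q u) (ha : 1 ≤ a)
    (hq : 0 < q + 1) (i : Fin n) {θ : ℝ → ℝ} {M κ : ℝ} (hκ : 0 < κ)
    (hθ : ContDiff ℝ 3 θ) (pθ : Function.Periodic θ 1)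
    (b1 : ∀ t, |deriv θ t| ≤ M) (b2 : ∀ t, |deriv (deriv θ) t| ≤ M)
    (b3 : ∀ t, |deriv (deriv (fun s => θ s ^ 2)) t| ≤ M * |θ t|)
    (hS : 12 * ∫ x in unitCube n, θ (x i) ^ 2 * u x ^ (q + 1)
      ≤ ∫ x in unitCube n, (lap (fun y => θ (y i) * u y) x + a * (θ (x i) * u x)) ^ 2) :
    (1 / 2) * (∫ x in unitCube n, κ * θ (x i) ^ 2 * (lap u x + a * u x) ^ 2)
      - (1 / (q + 1)) * (∫ x in unitCube n, κ * θ (x i) ^ 2 * u x ^ (q + 1))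
      + (∫ x in unitCube n, deriv (fun t => κ * θ t ^ 2) (x i) * (lap u x + a * u x)
          * pderiv' i u x)
      + 2 * (∫ x in unitCube n, κ * θ (x i) ^ 2 * (lap u x + a * u x) * pderiv' i (pderiv' i u) x)
    ≤ 1000 * κ * M ^ 2 * ∫ x in unitCube n, u x * (lap u x + a * u x) := by
  obtain ⟨hA, hH⟩ := h.local_estimate ha i hθ pθ b1 b2 b3 hS
  obtain ⟨hJ0, hJ1⟩ := h.J_bounds ha
  replace hJ1 := hJ1 i
  have hJp : 0 ≤ ∫ x in unitCube n, u x ^ 2 := I_nonneg fun x => sq_nonneg _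
  have hc : ∀ {f : ℝ → ℝ}, Continuous f → Continuous (fun x : En n => f (x i)) := fun hf =>
    hf.comp (EuclideanSpace.proj i : En n →L[ℝ] ℝ).continuous
  have cθ := hc hθ.continuous
  have cu := h.smooth.continuous
  have cv : Continuous (fun x => lap u x + a * u x) := h.v_smooth.continuous
  have cd : Continuous (pderiv' i u) :=
    (pd_contDiff (m := 3) i h.smooth).continuous
  have cdd : Continuous (pderiv' i (pderiv' i u)) :=
    (pd_contDiff (m := 2) i (pd_contDiff (m := 3) i h.smooth)).continuous
  have dθ : Differentiable ℝ θ := hθ.differentiable (by norm_num)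
  have cθ1 := hc (hθ.continuous_deriv (by norm_num))
  have eψ : deriv (fun t => κ * θ t ^ 2) = fun t => κ * (2 * θ t * deriv θ t) := by
    funext t
    have := (((dθ t).hasDerivAt.pow 2).const_mul κ).deriv
    refine Eq.trans this ?_
    push_cast
    ring
  have t1 : ∫ x in unitCube n, κ * θ (x i) ^ 2 * (lap u x + a * u x) ^ 2
      = κ * ∫ x in unitCube n, θ (x i) ^ 2 * (lap u x + a * u x) ^ 2 := by
    rw [← I_smul]; simp only [mul_assoc]
  have t2 : 0 ≤ ∫ x in unitCube n, κ * θ (x i) ^ 2 * u x ^ (q + 1) :=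
    I_nonneg fun x => by have := Real.rpow_nonneg (h.pos x).le (q + 1); positivity
  have t2' := mul_nonneg (one_div_pos.2 hq).le t2
  have c1 : Continuous (fun x : En n => θ (x i) ^ 2 * (lap u x + a * u x) ^ 2) := by fun_prop
  have c2 : Continuous (fun x : En n => θ (x i) ^ 2 * (pderiv' i (pderiv' i u) x) ^ 2) := by fun_prop
  have c3 : Continuous (fun x : En n => M ^ 2 * (pderiv' i u x) ^ 2) := by fun_prop
  have t3 : ∫ x in unitCube n, deriv (fun t => κ * θ t ^ 2) (x i) * (lap u x + a * u x)
          * pderiv' i u x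
      ≤ κ * ((∫ x in unitCube n, θ (x i) ^ 2 * (lap u x + a * u x) ^ 2)
          + M ^ 2 * ∫ x in unitCube n, (pderiv' i u x) ^ 2) := by
    rw [eψ, ← I_smul, ← I_add c1 c3, ← I_smul]
    refine I_mono (by fun_prop) (by fun_prop) fun x => ?_
    have hM := abs_le.1 (b1 (x i))
    have hM2 : deriv θ (x i) ^ 2 ≤ M ^ 2 := sq_le_sq' hM.1 hM.2
    have k1 := mul_le_mul_of_nonneg_right hM2 (sq_nonneg (pderiv' i u x))
    have k2 := sq_nonneg (θ (x i) * (lap u x + a * u x) - deriv θ (x i) * pderiv' i u x)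
    have : 2 * θ (x i) * deriv θ (x i) * (lap u x + a * u x) * pderiv' i u x
      ≤ θ (x i) ^ 2 * (lap u x + a * u x) ^ 2 + M ^ 2 * (pderiv' i u x) ^ 2 := by nlinarith
    have := mul_le_mul_of_nonneg_left this hκ.le
    linarith
  have t4 : 2 * ∫ x in unitCube n, κ * θ (x i) ^ 2 * (lap u x + a * u x)
          * pderiv' i (pderiv' i u) x
      ≤ κ * ((∫ x in unitCube n, θ (x i) ^ 2 * (lap u x + a * u x) ^ 2)
          + ∫ x in unitCube n, θ (x i) ^ 2 * (pderiv' i (pderiv' i u) x) ^ 2) := by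
    rw [← I_smul, ← I_add c1 c2, ← I_smul]
    refine I_mono (by fun_prop) (by fun_prop) fun x => ?_
    have k2 := mul_nonneg (mul_nonneg hκ.le (sq_nonneg (θ (x i))))
      (sq_nonneg ((lap u x + a * u x) - pderiv' i (pderiv' i u) x))
    linarith
  rw [t1]
  set J := ∫ x in unitCube n, u x * (lap u x + a * u x)
  have J0 : 0 ≤ J := hJp.trans hJ0
  have w1 := mul_le_mul_of_nonneg_left hA hκ.le
  have w2 := mul_le_mul_of_nonneg_left hH hκ.le
  have w3 := mul_le_mul_of_nonneg_left (mul_le_mul_of_nonneg_left hJ1 (sq_nonneg M)) hκ.le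
  have w4 : 0 ≤ κ * (M ^ 2 * J) := by positivity
  linarith

theorem IsSol.smallness {n : ℕ} (hn : 5 ≤ n) {a q : ℝ} {u : En n → ℝ} (h : IsSol a q u)
    (ha : 1 ≤ a) (hq : q + 1 = 2 * n / (n - 4)) {S : ℝ} (S0 : 0 < S)
    (hS : ∀ g : En n → ℝ, ContDiff ℝ 2 g → ZPeriodic g →
      (∫ x in unitCube n, |g x| ^ (2 * n / (n - 4) : ℝ)) ^ (((n : ℝ) - 4) / n)
        ≤ S * ∫ x in unitCube n, hDens g x)
    {ε : ℝ} (hε : 12 * (ε ^ ((4 : ℝ) / n) * S) ≤ 1) (i : Fin n) {θ : ℝ → ℝ}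
    (hθ : ContDiff ℝ 3 θ) (pθ : Function.Periodic θ 1)
    (hsm : ∫ x in unitCube n, {x : En n | θ (x i) ≠ 0}.indicator
            (fun x => u x ^ (2 * n / (n - 4) : ℝ)) x ≤ ε) :
    12 * ∫ x in unitCube n, θ (x i) ^ 2 * u x ^ (q + 1)
      ≤ ∫ x in unitCube n, (lap (fun y => θ (y i) * u y) x + a * (θ (x i) * u x)) ^ 2 := by
  rw [hq]
  have H := slab_holder hn h.smooth.continuous h.pos i hθ.continuous
  have sg : ContDiff ℝ 3 (fun y : En n => θ (y i) * u y) :=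
    (contDiff_coord i hθ).mul (h.smooth.of_le (by norm_num))
  have pg : ZPeriodic (fun y : En n => θ (y i) * u y) :=
    periodic_mul (periodic_coord i pθ) h.per
  have H2 := hS _ (sg.of_le (by norm_num)) pg
  have H3 := integral_hDens_le sg pg ha
  set T := ∫ x in unitCube n, {x : En n | θ (x i) ≠ 0}.indicator
            (fun x => u x ^ (2 * n / (n - 4) : ℝ)) x
  have T0 : 0 ≤ T := I_nonneg fun x =>
    Set.indicator_nonneg (fun x _ => Real.rpow_nonneg (h.pos x).le _) x
  have H4 : T ^ ((4 : ℝ) / n) ≤ ε ^ ((4 : ℝ) / n) := Real.rpow_le_rpow T0 hsm (by positivity)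
  set B := ∫ x in unitCube n, (lap (fun y => θ (y i) * u y) x + a * (θ (x i) * u x)) ^ 2
  have B0 : 0 ≤ B := I_nonneg fun x => sq_nonneg _
  set X := (∫ x in unitCube n, |θ (x i) * u x| ^ (2 * n / (n - 4) : ℝ)) ^ (((n : ℝ) - 4) / n)
  have X0 : 0 ≤ X := Real.rpow_nonneg (I_nonneg fun x => Real.rpow_nonneg (abs_nonneg _) _) _
  have X1 : X ≤ S * B := H2.trans (mul_le_mul_of_nonneg_left H3 S0.le)
  have e0 : 0 ≤ ε ^ ((4 : ℝ) / n) := Real.rpow_nonneg (T0.trans hsm) _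
  have := mul_le_mul H4 X1 X0 e0
  have := mul_le_mul_of_nonneg_right hε B0
  linarith

theorem main_aux (n : ℕ) (hn : 5 ≤ n) (Λ : ℝ) : ∃ α₀ : ℝ, 0 < α₀ ∧ ∀ α : ℝ, α₀ ≤ α →
    ∀ u : En n → ℝ, IsSol (α / 2) (((n : ℝ) + 4) / ((n : ℝ) - 4)) u →
      (∫ x in unitCube n, u x ^ (2 * (n : ℝ) / ((n : ℝ) - 4))) ≤ Λ → False := by
  have h5 : (5 : ℝ) ≤ n := by exact_mod_cast hn
  have n4 : (n : ℝ) - 4 ≠ 0 := by linarith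
  obtain ⟨S, S0, hS⟩ := sobolev_torus n hn
  obtain ⟨m, m0, hm⟩ := exists_m n hn S Λ
  obtain ⟨θ, φ, M, κ, M0, κ0, sθ, pθ, b1, b2, b3, hd, sφ, pφ, dφ⟩ := exists_cutoffs m
  refine ⟨n * (1000 * κ * M ^ 2) + 2, by positivity, fun α hα u h hE => ?_⟩
  have hpos : 0 ≤ (n : ℝ) * (1000 * κ * M ^ 2) := by positivity
  have ha : 1 ≤ α / 2 := by linarith
  have hq : ((n : ℝ) + 4) / ((n : ℝ) - 4) + 1 = 2 * n / (n - 4) := by field_simp; ring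
  have hq0 : 0 < ((n : ℝ) + 4) / ((n : ℝ) - 4) + 1 := by
    rw [hq]; apply div_pos <;> linarith
  have hnq : (n : ℝ) / (((n : ℝ) + 4) / ((n : ℝ) - 4) + 1) = n / 2 - 2 := by
    rw [hq]; field_simp; ring
  have cup : Continuous (fun x => u x ^ (2 * (n : ℝ) / ((n : ℝ) - 4))) :=
    h.smooth.continuous.rpow_const fun x => Or.inl (h.pos x).ne'
  have hj := fun i : Fin n => exists_slab m0 cup (fun x => Real.rpow_pos_of_pos (h.pos x) _) hE i
    (fun j => (sθ j).continuous) hd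
  choose j hj using hj
  have hP := h.pohozaev hq0 hnq (φ := fun i => φ (j i)) (ψ := fun i t => κ * θ (j i) t ^ 2)
    (fun i => sφ _) (fun i => pφ _)
    (fun i => contDiff_const.mul (((sθ (j i)).of_le (by norm_num)).pow 2)) (fun i => dφ _)
  have hT := fun i => h.term_bound ha hq0 i κ0 (sθ (j i)) (pθ _) (b1 _) (b2 _) (b3 _)
    (h.smallness hn ha hq S0 hS hm i (sθ (j i)) (pθ _) (hj i))
  have hsum := Finset.sum_le_sum (s := Finset.univ) fun i _ => hT i
  rw [← hP] at hsum
  simp only [Finset.sum_const, Finset.card_univ, Fintype.card_fin, nsmul_eq_mul] at hsum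
  have hJ := (h.J_bounds ha).1
  have hJ0 := integral_sq_pos h.smooth.continuous h.pos
  set J := ∫ x in unitCube n, u x * (lap u x + α / 2 * u x)
  have Jp : 0 < J := lt_of_lt_of_le hJ0 hJ
  nlinarith

/-- Theorem 0.1 on the flat torus: for every `Λ > 0` there is `α₀ > 0` such that for
`α ≥ α₀` there is no positive `ℤⁿ`-periodic `C⁴` solution of `(Δ + α/2)² u = u^{2♯-1}`
with energy `∫_{[0,1]ⁿ} u^{2♯} ≤ Λ`. -/
theorem energy_function_tendsto_infinity_torus (n : ℕ) (hn : 5 ≤ n) :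
    ∀ Λ : ℝ, 0 < Λ → ∃ α₀ : ℝ, 0 < α₀ ∧ ∀ α : ℝ, α₀ ≤ α →
      ¬ ∃ u : En n → ℝ, ContDiff ℝ 4 u ∧ (∀ x, 0 < u x) ∧ ZPeriodic u ∧
          (∀ x : En n,
            lap (fun y => lap u y + (α / 2) * u y) x
              + (α / 2) * (lap u x + (α / 2) * u x)
            = u x ^ (((n : ℝ) + 4) / ((n : ℝ) - 4))) ∧
          (∫ x in unitCube n, u x ^ (2 * (n : ℝ) / ((n : ℝ) - 4))) ≤ Λ := by
  intro Λ _
  obtain ⟨α₀, h0, h⟩ := main_aux n hn Λ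
  refine ⟨α₀, h0, fun α hα => ?_⟩
  rintro ⟨u, h1, h2, h3, h4, h5⟩
  exact h α hα u ⟨h1, h2, h3, h4⟩ h5
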